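/- arXiv:1711.03839 — 2 statements merged into one kernel-verified Lean document; each statement's English description precedes it below -/
import Mathlib

section
/- Suppose f and h satisfy: (A2) each f_i is uniformly bounded; (A3) for each i ∈ I, h_i is uniformly bounded, measurable in t, continuous in ξ uniformly in t, and precompact, and f_i = f̂_i + Δf_i where f̂_i is uniformly bounded, measurable in t, continuous in ξ uniformly in t, and precompact, and (h_i, Δf_i) is a zeroing pair. Let 𝒯 be a family of trajectories of ẋ = f(t,x,σ(t)) invariant w.r.t. a closed covering χ of ℝ^n. If (x̄, ū) is a 𝒯-zeroing-output limiting trajectory of the system with output y = h(t,x,σ(t)), then there exists γ ∈ Λ := ∩_{i∈I}[Λ(f̂_i) ∩ Λ(h_i)] such that (x̄, ū) is a bounded complete trajectory of the reduced limiting control system Σ_γ; that is, x̄(ℝ) is contained in a compact subset of 𝒳, ū ∈ 𝒮*_𝒯, and for almost all t ∈ ℝ: ū(t) ∈ U_{x̄(t)}, x̄′(t) = Σ_{i=1}^N ū_i(t) f̂_{i,γ}(t, x̄(t)), and Σ_{i=1}^N ū_i(t) |h_{i,γ}(t, x̄(t))| = 0. -/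
open MeasureTheory Filter Set Topology

noncomputable section

namespace SwitchedSys

/-- Euclidean state space ℝⁿ. -/
abbrev E (n : ℕ) := EuclideanSpace ℝ (Fin n)

/-! ### Comparison function classes -/

/-- Class 𝒦 functions (on [0,∞)). -/
def ClassK (α : ℝ → ℝ) : Prop :=
  ContinuousOn α (Ici 0) ∧ StrictMonoOn α (Ici 0) ∧ α 0 = 0

/-- Class 𝒦∞ functions. -/
def ClassKInf (α : ℝ → ℝ) : Prop :=
  ClassK α ∧ Tendsto α atTop atTop

/-- Class 𝒦ℒ functions. -/
def ClassKL (β : ℝ → ℝ → ℝ) : Prop :=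
  (∀ t, 0 ≤ t → ClassKInf fun r => β r t) ∧
  ∀ r, 0 ≤ r → AntitoneOn (fun t => β r t) (Ici 0) ∧
    Tendsto (fun t => β r t) atTop (nhds 0)

/-! ### Switching signals, controls and weak convergence -/

/-- A switching signal: piecewise constant and continuous from the right, with at most
finitely many jumps in each compact interval. -/
def IsSwitchingSignal {N : ℕ} (σ : ℝ → Fin N) : Prop :=
  ∀ a b : ℝ, a < b → ∃ (k : ℕ) (τ : ℕ → ℝ), τ 0 = a ∧ τ k = b ∧
    (∀ j, j < k → τ j < τ (j + 1)) ∧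
    ∀ j, j < k → ∀ s ∈ Ico (τ j) (τ (j + 1)), σ s = σ (τ j)

/-- The standard simplex U ⊆ ℝᴺ. -/
def simplexU (N : ℕ) : Set (Fin N → ℝ) := {μ | (∀ i, 0 ≤ μ i) ∧ ∑ i, μ i = 1}

/-- The set 𝒰 of admissible controls: measurable functions with values in the simplex. -/
def IsControl {N : ℕ} (u : ℝ → Fin N → ℝ) : Prop :=
  Measurable u ∧ ∀ t, u t ∈ simplexU N

/-- The i-th canonical basis vector of ℝᴺ. -/
def stdVec (N : ℕ) (i : Fin N) : Fin N → ℝ := fun j => if j = i then 1 else 0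

/-- The control u_σ = e_{σ(·)} associated with a switching signal σ. -/
def ctrlOfSwitch {N : ℕ} (σ : ℝ → Fin N) : ℝ → Fin N → ℝ := fun t => stdVec N (σ t)

/-- Weak convergence u_k ⇀ v, tested against all f ∈ L¹(ℝ,ℝᴺ). -/
def WeakConv {N : ℕ} (u : ℕ → ℝ → Fin N → ℝ) (v : ℝ → Fin N → ℝ) : Prop :=
  ∀ g : ℝ → Fin N → ℝ, Integrable g volume →
    Tendsto (fun k => ∫ t : ℝ, ∑ i, g t i * u k t i)
      atTop (nhds (∫ t : ℝ, ∑ i, g t i * v t i))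

/-! ### Regularity notions for time-varying maps -/

/-- g(t,ξ) is uniformly bounded: bounded on J′ × K for each compact K ⊆ 𝒳,
where J′ ⊆ [0,∞) has full measure. -/
def UnifBounded {X F : Type*} [TopologicalSpace X] [NormedAddCommGroup F]
    (𝒳 : Set X) (g : ℝ → X → F) : Prop :=
  ∃ J' ⊆ Ici (0:ℝ), volume (Ici (0:ℝ) \ J') = 0 ∧
    ∀ K : Set X, IsCompact K → K ⊆ 𝒳 → ∃ C : ℝ, ∀ t ∈ J', ∀ ξ ∈ K, ‖g t ξ‖ ≤ C

/-- g(t,ξ) is continuous in ξ uniformly in t (via a class 𝒦 modulus of continuity on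
each compact subset of 𝒳). -/
def ContXiUnifT {X F : Type*} [NormedAddCommGroup X] [NormedAddCommGroup F]
    (𝒳 : Set X) (g : ℝ → X → F) : Prop :=
  ∃ J' ⊆ Ici (0:ℝ), volume (Ici (0:ℝ) \ J') = 0 ∧
    ∀ K : Set X, IsCompact K → K ⊆ 𝒳 → ∃ ω : ℝ → ℝ, ClassK ω ∧
      ∀ t ∈ J', ∀ ξ ∈ K, ∀ ζ ∈ K, ‖g t ξ - g t ζ‖ ≤ ω ‖ξ - ζ‖

/-- g(t,ξ) is locally Lipschitz in ξ uniformly in t. -/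
def LipXiUnifT {X F : Type*} [NormedAddCommGroup X] [NormedAddCommGroup F]
    (𝒳 : Set X) (g : ℝ → X → F) : Prop :=
  ∃ J' ⊆ Ici (0:ℝ), volume (Ici (0:ℝ) \ J') = 0 ∧
    ∀ K : Set X, IsCompact K → K ⊆ 𝒳 → ∃ L : ℝ, 0 ≤ L ∧
      ∀ t ∈ J', ∀ ξ ∈ K, ∀ ζ ∈ K, ‖g t ξ - g t ζ‖ ≤ L * ‖ξ - ζ‖

/-- gγ is the limiting function of g along the sequence γ = {t_k}: g(t_k+s,ξ) → gγ(s,ξ)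
for all ξ ∈ 𝒳 and all s outside a Lebesgue-null set. -/
def IsLimitAlong {X F : Type*} [TopologicalSpace F]
    (𝒳 : Set X) (g : ℝ → X → F) (γ : ℕ → ℝ) (glim : ℝ → X → F) : Prop :=
  ∃ Eγ : Set ℝ, volume Eγ = 0 ∧ ∀ ξ ∈ 𝒳, ∀ s : ℝ, s ∉ Eγ →
    Tendsto (fun k => g (γ k + s) ξ) atTop (nhds (glim s ξ))

/-- γ is an admissible sequence for g. -/
def Admissible {X F : Type*} [TopologicalSpace F]
    (𝒳 : Set X) (g : ℝ → X → F) (γ : ℕ → ℝ) : Prop :=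
  Tendsto γ atTop atTop ∧ ∃ glim : ℝ → X → F, IsLimitAlong 𝒳 g γ glim

/-- g is precompact: every sequence t_k → ∞ has an admissible subsequence. -/
def Precompact {X F : Type*} [TopologicalSpace F]
    (𝒳 : Set X) (g : ℝ → X → F) : Prop :=
  ∀ t : ℕ → ℝ, Tendsto t atTop atTop →
    ∃ φ : ℕ → ℕ, StrictMono φ ∧ Admissible 𝒳 g (t ∘ φ)

/-- (g, gh) is a zeroing pair. -/
def ZeroingPair {X F G : Type*} [NormedAddCommGroup X] [NormedAddCommGroup F]
    [NormedAddCommGroup G] (𝒳 : Set X) (g : ℝ → X → F) (gh : ℝ → X → G) : Prop :=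
  ∀ t : ℕ → ℝ, Tendsto t atTop atTop → ∀ K : Set X, IsCompact K → K ⊆ 𝒳 →
    ∀ ε : ℝ, 0 < ε → ∀ v : ℕ → X, (∀ k, v k ∈ K) → (∀ k, ε ≤ ‖v k‖) →
      Tendsto (fun k => g (t k) (v k)) atTop (nhds 0) →
      Tendsto (fun k => gh (t k) (v k)) atTop (nhds 0)

/-- Carathéodory conditions for a time-varying vector field on 𝒳. -/
def Caratheodory {n : ℕ} (𝒳 : Set (E n)) (g : ℝ → E n → E n) : Prop :=
  (∀ ξ ∈ 𝒳, Measurable fun t => g t ξ) ∧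
  (∀ᵐ t ∂volume.restrict (Ici (0:ℝ)), ContinuousOn (fun ξ => g t ξ) 𝒳) ∧
  ∀ K : Set (E n), IsCompact K → K ⊆ 𝒳 →
    ∃ m : ℝ → ℝ, (∀ a b : ℝ, IntervalIntegrable m volume a b) ∧
      ∀ᵐ t ∂volume.restrict (Ici (0:ℝ)), ∀ ξ ∈ K, ‖g t ξ‖ ≤ m t

/-! ### Solutions and trajectories of the switched system -/

/-- A (forward) solution of ẋ = f(t,x,σ(t)) on [t0, tf), encoded through the equivalent
integral equation (x is locally absolutely continuous with ẋ(t) = f(t,x(t),σ(t)) a.e.). -/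
structure Sol {n N : ℕ} (𝒳 : Set (E n)) (f : ℝ → E n → Fin N → E n) where
  x : ℝ → E n
  σ : ℝ → Fin N
  t0 : ℝ
  tf : EReal
  t0_nonneg : 0 ≤ t0
  t0_lt_tf : (t0 : EReal) < tf
  switching : IsSwitchingSignal σ
  mem : ∀ t : ℝ, t0 ≤ t → (t : EReal) < tf → x t ∈ 𝒳
  intg : ∀ a b : ℝ, t0 ≤ a → a ≤ b → (b : EReal) < tf →
    IntervalIntegrable (fun τ => f τ (x τ) (σ τ)) volume a b
  sol : ∀ a b : ℝ, t0 ≤ a → a ≤ b → (b : EReal) < tf →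
    x b = x a + ∫ τ in a..b, f τ (x τ) (σ τ)

variable {n N : ℕ} {𝒳 : Set (E n)} {f : ℝ → E n → Fin N → E n}

/-- t belongs to the domain [t0, tf) of the solution. -/
def Sol.InDom (T : Sol 𝒳 f) (t : ℝ) : Prop := T.t0 ≤ t ∧ (t : EReal) < T.tf

/-- A solution is maximal if it admits no proper extension (a trajectory is a maximal
solution together with its switching signal). -/
def Sol.IsMaximal (T : Sol 𝒳 f) : Prop :=
  ¬ ∃ T' : Sol 𝒳 f, T'.σ = T.σ ∧ T'.t0 = T.t0 ∧ T.tf < T'.tf ∧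
    ∀ t : ℝ, T.InDom t → T'.x t = T.x t

/-! ### Stability notions -/

/-- Uniform stability of a family of trajectories. -/
def US (𝒯 : Set (Sol 𝒳 f)) : Prop :=
  ∃ α : ℝ → ℝ, ∃ δ₀ : ℝ, ClassK α ∧ 0 < δ₀ ∧
    ∀ T ∈ 𝒯, ∀ s : ℝ, T.InDom s → ‖T.x s‖ ≤ δ₀ →
      ∀ t : ℝ, s ≤ t → (t : EReal) < T.tf → ‖T.x t‖ ≤ α ‖T.x s‖

/-- Global uniform stability of a family of trajectories. -/
def GUS (𝒯 : Set (Sol 𝒳 f)) : Prop :=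
  𝒳 = Set.univ ∧ ∃ α : ℝ → ℝ, ClassKInf α ∧
    ∀ T ∈ 𝒯, ∀ s : ℝ, T.InDom s →
      ∀ t : ℝ, s ≤ t → (t : EReal) < T.tf → ‖T.x t‖ ≤ α ‖T.x s‖

/-- Uniform asymptotic stability of a family of trajectories. -/
def UAS (𝒯 : Set (Sol 𝒳 f)) : Prop :=
  ∃ β : ℝ → ℝ → ℝ, ∃ δ₀ : ℝ, ClassKL β ∧ 0 < δ₀ ∧
    ∀ T ∈ 𝒯, ∀ s : ℝ, T.InDom s → ‖T.x s‖ < δ₀ →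
      ∀ t : ℝ, s ≤ t → (t : EReal) < T.tf → ‖T.x t‖ ≤ β ‖T.x s‖ (t - s)

/-- Global uniform asymptotic stability of a family of trajectories. -/
def GUAS (𝒯 : Set (Sol 𝒳 f)) : Prop :=
  𝒳 = Set.univ ∧ ∃ β : ℝ → ℝ → ℝ, ClassKL β ∧
    ∀ T ∈ 𝒯, ∀ s : ℝ, T.InDom s →
      ∀ t : ℝ, s ≤ t → (t : EReal) < T.tf → ‖T.x t‖ ≤ β ‖T.x s‖ (t - s)

/-! ### Output maps, zeroing-output sequences and WZSD -/

/-- A 𝒯-zeroing-output sequence for the switched system with output map h. -/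
def ZeroingOutputSeq {F : Type*} [NormedAddCommGroup F]
    (𝒯 : Set (Sol 𝒳 f)) (h : ℝ → E n → Fin N → F)
    (t : ℕ → ℝ) (T : ℕ → Sol 𝒳 f) : Prop :=
  Tendsto t atTop atTop ∧ (∀ k, T k ∈ 𝒯) ∧
  (∀ k : ℕ, (T k).t0 ≤ t k - k ∧ ((t k + k : ℝ) : EReal) < (T k).tf) ∧
  (∃ K : Set (E n), IsCompact K ∧ K ⊆ 𝒳 ∧ ∃ ε : ℝ, 0 < ε ∧
    ∀ k : ℕ, ∀ s : ℝ, |s| ≤ (k : ℝ) →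
      (T k).x (t k + s) ∈ K ∧ ε ≤ ‖(T k).x (t k + s)‖) ∧
  ∀ᵐ s : ℝ, Tendsto (fun k => h (t k + s) ((T k).x (t k + s)) ((T k).σ (t k + s)))
    atTop (nhds 0)

/-- The pair (h,f) is weakly zero-state detectable with respect to 𝒯:
there is no 𝒯-zeroing-output sequence. -/
def WZSD {F : Type*} [NormedAddCommGroup F]
    (𝒯 : Set (Sol 𝒳 f)) (h : ℝ → E n → Fin N → F) : Prop :=
  ¬ ∃ (t : ℕ → ℝ) (T : ℕ → Sol 𝒳 f), ZeroingOutputSeq 𝒯 h t T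

/-- Assumption 1: integral bound for the output along trajectories of 𝒯. -/
def IntegralOutputBound {F : Type*} [NormedAddCommGroup F]
    (𝒯 : Set (Sol 𝒳 f)) (h : ℝ → E n → Fin N → F) : Prop :=
  ∃ α : ℝ → ℝ, ContinuousOn α (Ici 0) ∧ α 0 = 0 ∧ (∀ r : ℝ, 0 < r → 0 < α r) ∧
    ∀ K : Set (E n), IsCompact K → K ⊆ 𝒳 → ∀ μ : ℝ, 0 < μ → ∃ M : ℝ, 0 < M ∧
      ∀ T ∈ 𝒯, ∀ s t : ℝ, T.t0 ≤ s → s < t → (t : EReal) < T.tf →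
        (∀ τ ∈ Icc s t, T.x τ ∈ K) →
        ∫ τ in s..t, α ‖h τ (T.x τ) (T.σ τ)‖ ≤ M + μ * (t - s)

/-! ### Coverings, limiting trajectories and reduced limiting control systems -/

/-- The set U_ξ = co{e_i : ξ ∈ χ_i} of control values compatible with the covering χ at ξ. -/
def Uset {N n : ℕ} (χ : Fin N → Set (E n)) (ξ : E n) : Set (Fin N → ℝ) :=
  convexHull ℝ {v : Fin N → ℝ | ∃ i, ξ ∈ χ i ∧ v = stdVec N i}

/-- 𝒯 is invariant with respect to the covering χ: x(t) ∈ χ_{σ(t)} along trajectories. -/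
def InvariantWrt (𝒯 : Set (Sol 𝒳 f)) (χ : Fin N → Set (E n)) : Prop :=
  ∀ T ∈ 𝒯, ∀ t : ℝ, T.InDom t → T.x t ∈ χ (T.σ t)

/-- The set 𝒮*_𝒯 of controls that are weak limits of time-translations of switching
signals of trajectories in 𝒯. -/
def SStar (𝒯 : Set (Sol 𝒳 f)) (u : ℝ → Fin N → ℝ) : Prop :=
  IsControl u ∧ ∃ (t : ℕ → ℝ) (T : ℕ → Sol 𝒳 f),
    Tendsto t atTop atTop ∧ (∀ k, T k ∈ 𝒯) ∧
    WeakConv (fun k s => ctrlOfSwitch (T k).σ (t k + s)) u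

/-- Limiting trajectory of the family 𝒯. -/
def LimitingTrajectory (𝒯 : Set (Sol 𝒳 f)) (xb : ℝ → E n) (ub : ℝ → Fin N → ℝ) : Prop :=
  Continuous xb ∧ (∀ t, xb t ∈ 𝒳) ∧ IsControl ub ∧
  ∃ (t : ℕ → ℝ) (T : ℕ → Sol 𝒳 f) (K : Set (E n)),
    Tendsto t atTop atTop ∧ (∀ k, T k ∈ 𝒯) ∧ IsCompact K ∧ K ⊆ 𝒳 ∧
    (∀ k : ℕ, (T k).t0 ≤ t k - k ∧ ((t k + k : ℝ) : EReal) < (T k).tf) ∧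
    (∀ k : ℕ, ∀ s : ℝ, |s| ≤ (k : ℝ) → (T k).x (t k + s) ∈ K) ∧
    (∀ Tc : ℝ, 0 < Tc →
      TendstoUniformlyOn (fun k s => (T k).x (t k + s)) xb atTop (Icc (-Tc) Tc)) ∧
    WeakConv (fun k s => ctrlOfSwitch (T k).σ (t k + s)) ub

/-- 𝒯-zeroing-output limiting trajectory. -/
def ZeroingOutputLimitingTrajectory {F : Type*} [NormedAddCommGroup F]
    (𝒯 : Set (Sol 𝒳 f)) (h : ℝ → E n → Fin N → F)
    (xb : ℝ → E n) (ub : ℝ → Fin N → ℝ) : Prop :=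
  Continuous xb ∧ (∀ t, xb t ∈ 𝒳) ∧ IsControl ub ∧
  ∃ (t : ℕ → ℝ) (T : ℕ → Sol 𝒳 f), ZeroingOutputSeq 𝒯 h t T ∧
    (∀ Tc : ℝ, 0 < Tc →
      TendstoUniformlyOn (fun k s => (T k).x (t k + s)) xb atTop (Icc (-Tc) Tc)) ∧
    WeakConv (fun k s => ctrlOfSwitch (T k).σ (t k + s)) ub

/-- Locally absolutely continuous function on ℝ (indefinite integral of a locally
integrable function). -/
def LocAC {V : Type*} [NormedAddCommGroup V] [NormedSpace ℝ V] (x : ℝ → V) : Prop :=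
  ∃ g : ℝ → V, (∀ a b : ℝ, IntervalIntegrable g volume a b) ∧
    ∀ t : ℝ, x t = x 0 + ∫ s in (0:ℝ)..t, g s

/-- A complete trajectory of the reduced limiting control system Σ_γ determined by the
limiting functions fl = (f̂_{i,γ}) and hl = (h_{i,γ}), the covering χ and the constraint
u ∈ 𝒮*_𝒯: x is locally absolutely continuous and, for a.e. t, u(t) ∈ U_{x(t)},
x′(t) = Σ_i u_i(t) f̂_{i,γ}(t,x(t)) and Σ_i u_i(t) |h_{i,γ}(t,x(t))| = 0. -/
def CompleteTrajOf {F : Type*} [NormedAddCommGroup F]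
    (𝒯 : Set (Sol 𝒳 f)) (χ : Fin N → Set (E n))
    (fl : Fin N → ℝ → E n → E n) (hl : Fin N → ℝ → E n → F)
    (x : ℝ → E n) (u : ℝ → Fin N → ℝ) : Prop :=
  (∀ t, x t ∈ 𝒳) ∧ LocAC x ∧ SStar 𝒯 u ∧
  ∀ᵐ t : ℝ, u t ∈ Uset χ (x t) ∧
    HasDerivAt x (∑ i, u t i • fl i t (x t)) t ∧
    ∑ i, u t i * ‖hl i t (x t)‖ = 0

/-- A bounded complete trajectory: the state stays in a compact subset of 𝒳. -/
def BoundedRange (𝒳 : Set (E n)) (x : ℝ → E n) : Prop :=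
  ∃ K : Set (E n), IsCompact K ∧ K ⊆ 𝒳 ∧ ∀ t : ℝ, x t ∈ K

end SwitchedSys

open SwitchedSys Filter Set MeasureTheory

lemma aux_ae_shift {J' : Set ℝ} (hJ : volume (Ici (0:ℝ) \ J') = 0) {γ : ℕ → ℝ}
    (hγ : Tendsto γ atTop atTop) : ∀ᵐ s : ℝ, ∀ᶠ k in atTop, γ k + s ∈ J' := by
  have h1 : ∀ k, ∀ᵐ s : ℝ, γ k + s ∉ Ici (0:ℝ) \ J' := fun k =>
    (measurePreserving_add_left volume (γ k)).quasiMeasurePreserving.ae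
      (p := fun s => s ∉ Ici (0:ℝ) \ J') (measure_eq_zero_iff_ae_notMem.1 hJ)
  filter_upwards [ae_all_iff.2 h1] with s hs
  filter_upwards [hγ.eventually_ge_atTop (-s)] with k hk
  by_contra h
  exact hs k ⟨by simp only [mem_Ici]; linarith, h⟩

lemma aux_classK_tendsto {X : Type*} [NormedAddCommGroup X] {ω : ℝ → ℝ} (hω : ClassK ω)
    {y : ℕ → X} {x : X} (hy : Tendsto y atTop (𝓝 x)) :
    Tendsto (fun k => ω ‖y k - x‖) atTop (𝓝 0) := by
  have h1 : Tendsto (fun k => ‖y k - x‖) atTop (𝓝[Ici 0] 0) :=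
    tendsto_nhdsWithin_iff.2 ⟨tendsto_iff_norm_sub_tendsto_zero.1 hy, by simp⟩
  have h2 := hω.1 0 (by simp)
  unfold ContinuousWithinAt at h2
  rw [hω.2.2] at h2
  exact h2.comp h1

lemma aux_floor_tendsto (s : ℝ) :
    Tendsto (fun m : ℕ => ((⌊((m:ℝ) + 1) * s⌋ : ℝ) + 1) / ((m:ℝ) + 1)) atTop (𝓝[>] s) := by
  have h0 : Tendsto (fun m : ℕ => 1 / ((m:ℝ) + 1)) atTop (𝓝 0) :=
    tendsto_one_div_add_atTop_nhds_zero_nat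
  have h1 : Tendsto (fun m : ℕ => s + 1 / ((m:ℝ) + 1)) atTop (𝓝 s) := by
    simpa using h0.const_add s
  have hlt : ∀ m : ℕ, s < ((⌊((m:ℝ) + 1) * s⌋ : ℝ) + 1) / ((m:ℝ) + 1) := fun m => by
    rw [lt_div_iff₀ (by positivity)]
    have := Int.lt_floor_add_one (((m:ℝ) + 1) * s)
    linarith
  refine tendsto_nhdsWithin_iff.2 ⟨?_, Eventually.of_forall hlt⟩
  refine tendsto_of_tendsto_of_tendsto_of_le_of_le tendsto_const_nhds h1
    (fun m => (hlt m).le) (fun m => ?_)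
  have hm : (0:ℝ) < (m:ℝ) + 1 := by positivity
  have := Int.floor_le (((m:ℝ) + 1) * s)
  simp only
  rw [add_div]
  gcongr
  rw [div_le_iff₀ hm]; linarith

lemma aux_switch_measurable {N : ℕ} {σ : ℝ → Fin N} (hσ : IsSwitchingSignal σ) :
    Measurable σ := by
  have hr : ∀ t, ∀ᶠ s in 𝓝[>] t, σ s = σ t := by
    intro t
    obtain ⟨k, τ, h0, hk, hm, hc⟩ := hσ t (t + 1) (by linarith)
    have hk0 : 0 < k := by
      rcases Nat.eq_zero_or_pos k with rfl | h
      · rw [h0] at hk; linarith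
      · exact h
    have hlt := hm 0 hk0
    rw [h0] at hlt
    filter_upwards [Ioo_mem_nhdsGT hlt] with s hs
    have := hc 0 hk0 s ⟨by rw [h0]; exact hs.1.le, hs.2⟩
    rw [this, h0]
  let S : ℕ → ℝ → Fin N := fun m s => σ (((⌊((m:ℝ) + 1) * s⌋ : ℝ) + 1) / ((m:ℝ) + 1))
  have hS : ∀ m, Measurable (S m) := fun m =>
    (measurable_from_top (f := fun j : ℤ => σ (((j : ℝ) + 1) / ((m:ℝ) + 1)))).comp
      (Int.measurable_floor.comp (measurable_const.mul measurable_id))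
  refine measurable_of_tendsto_metrizable hS (tendsto_pi_nhds.2 fun s => ?_)
  refine tendsto_const_nhds.congr' ?_
  filter_upwards [(aux_floor_tendsto s).eventually (hr s)] with m hm
  exact hm.symm

lemma aux_ctrl_measurable {N : ℕ} {σ : ℝ → Fin N} (hσ : IsSwitchingSignal σ) (c : ℝ) :
    Measurable fun s => ctrlOfSwitch σ (c + s) :=
  (measurable_from_top (f := stdVec N)).comp
    ((aux_switch_measurable hσ).comp (measurable_const.add measurable_id))

lemma aux_ctrl_simplex {N : ℕ} (σ : ℝ → Fin N) (t : ℝ) : ctrlOfSwitch σ t ∈ simplexU N := by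
  refine ⟨fun i => ?_, ?_⟩
  · simp only [ctrlOfSwitch, stdVec]; split_ifs <;> norm_num
  · simp [ctrlOfSwitch, stdVec]

lemma aux_ctrl_sum {N : ℕ} {V : Type*} [NormedAddCommGroup V] [NormedSpace ℝ V]
    (σ : ℝ → Fin N) (t : ℝ) (g : Fin N → V) :
    ∑ i, ctrlOfSwitch σ t i • g i = g (σ t) := by
  simp [ctrlOfSwitch, stdVec]

lemma aux_simplex_norm {N : ℕ} {V : Type*} [NormedAddCommGroup V] [NormedSpace ℝ V]
    {μ : Fin N → ℝ} (hμ : μ ∈ simplexU N) {g : Fin N → V} {C : ℝ} (hg : ∀ i, ‖g i‖ ≤ C) :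
    ‖∑ i, μ i • g i‖ ≤ C := by
  calc ‖∑ i, μ i • g i‖ ≤ ∑ i, ‖μ i • g i‖ := norm_sum_le _ _
    _ ≤ ∑ i, μ i * C := by
        refine Finset.sum_le_sum fun i _ => ?_
        rw [norm_smul, Real.norm_of_nonneg (hμ.1 i)]
        exact mul_le_mul_of_nonneg_left (hg i) (hμ.1 i)
    _ = C := by rw [← Finset.sum_mul, hμ.2, one_mul]

lemma aux_countable_meas {F : Type*} [NormedAddCommGroup F] [MeasurableSpace F] [BorelSpace F]
    [SecondCountableTopology F] {r : ℝ → ℤ} (hr : Measurable r) {h : ℤ → ℝ → F}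
    (hj : ∀ j, AEStronglyMeasurable (h j) volume) :
    AEStronglyMeasurable (fun s => h (r s) s) volume := by
  choose g hg hgh using hj
  have hM : Measurable (fun p : ℤ × ℝ => g p.1 p.2) :=
    measurable_from_prod_countable_right (fun j => (hg j).measurable)
  have hM2 : Measurable (fun s : ℝ => g (r s) s) :=
    hM.comp (hr.prodMk measurable_id)
  refine hM2.aestronglyMeasurable.congr ?_
  filter_upwards [ae_all_iff.2 hgh] with s hs
  exact (hs (r s)).symm

/-- Properties of the limiting function along a limit curve. -/
lemma aux_limit {n : ℕ} {F : Type*} [NormedAddCommGroup F] [MeasurableSpace F] [BorelSpace F]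
    [SecondCountableTopology F]
    {𝒳 K : Set (E n)} {G Gl : ℝ → E n → F} {γ : ℕ → ℝ}
    (hK : IsCompact K) (hKX : K ⊆ 𝒳)
    (hb : UnifBounded 𝒳 G) (hm : ∀ ξ ∈ 𝒳, Measurable fun t => G t ξ)
    (hc : ContXiUnifT 𝒳 G) (hγ : Tendsto γ atTop atTop) (hl : IsLimitAlong 𝒳 G γ Gl)
    {xb : ℝ → E n} (hxc : Continuous xb) (hxK : ∀ t, xb t ∈ K) :
    AEStronglyMeasurable (fun s => Gl s (xb s)) volume ∧
    (∃ C, ∀ᵐ s : ℝ, ‖Gl s (xb s)‖ ≤ C) ∧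
    (∀ᵐ s : ℝ, ∀ y : ℕ → E n, (∀ᶠ k in atTop, y k ∈ K) → Tendsto y atTop (𝓝 (xb s)) →
      Tendsto (fun k => G (γ k + s) (y k)) atTop (𝓝 (Gl s (xb s)))) := by
  obtain ⟨J1, -, hJ1, hb⟩ := hb
  obtain ⟨J2, -, hJ2, hc⟩ := hc
  obtain ⟨C, hC⟩ := hb K hK hKX
  obtain ⟨ω, hω, hωK⟩ := hc K hK hKX
  obtain ⟨Z, hZ, hlim⟩ := hl
  have hZ' : ∀ᵐ s : ℝ, s ∉ Z := measure_eq_zero_iff_ae_notMem.1 hZ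
  have a1 := aux_ae_shift hJ1 hγ
  have a2 := aux_ae_shift hJ2 hγ
  have hmod : ∀ᵐ s : ℝ, ∀ ξ ∈ K, ∀ ζ ∈ K, ‖Gl s ξ - Gl s ζ‖ ≤ ω ‖ξ - ζ‖ := by
    filter_upwards [hZ', a2] with s hs h2 ξ hξ ζ hζ
    refine le_of_tendsto ((hlim ξ (hKX hξ) s hs).sub (hlim ζ (hKX hζ) s hs)).norm ?_
    filter_upwards [h2] with k hk
    exact hωK _ hk _ hξ _ hζ
  refine ⟨?_, ⟨C, ?_⟩, ?_⟩
  · have hGm : ∀ ξ ∈ 𝒳, AEStronglyMeasurable (fun s => Gl s ξ) volume := by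
      intro ξ hξ
      refine aestronglyMeasurable_of_tendsto_ae (f := fun k s => G (γ k + s) ξ) atTop
        (fun k => ((hm ξ hξ).comp (measurable_const.add measurable_id)).aestronglyMeasurable) ?_
      filter_upwards [hZ'] with s hs
      exact hlim ξ hξ s hs
    let q : ℕ → ℤ → ℝ := fun m j => ((j : ℝ) + 1) / ((m:ℝ) + 1)
    let r : ℕ → ℝ → ℤ := fun m s => ⌊((m:ℝ) + 1) * s⌋
    have hr : ∀ m, Measurable (r m) := fun m =>
      Int.measurable_floor.comp (measurable_const.mul measurable_id)
    refine aestronglyMeasurable_of_tendsto_ae (f := fun m s => Gl s (xb (q m (r m s)))) atTop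
      (fun m => ?_) ?_
    · exact aux_countable_meas (hr m) (h := fun j s => Gl s (xb (q m j)))
        fun j => hGm _ (hKX (hxK _))
    · filter_upwards [hmod] with s hs
      have hx : Tendsto (fun m => xb (q m (r m s))) atTop (𝓝 (xb s)) :=
        (hxc.tendsto s).comp ((aux_floor_tendsto s).mono_right nhdsWithin_le_nhds)
      rw [tendsto_iff_norm_sub_tendsto_zero]
      exact squeeze_zero (fun _ => norm_nonneg _) (fun m => hs _ (hxK _) _ (hxK _))
        (aux_classK_tendsto hω hx)
  · filter_upwards [hZ', a1] with s hs h1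
    refine le_of_tendsto (hlim _ (hKX (hxK s)) s hs).norm ?_
    filter_upwards [h1] with k hk
    exact hC _ hk _ (hxK s)
  · filter_upwards [hZ', a2] with s hs h2 y hyK hy
    have h3 : Tendsto (fun k => G (γ k + s) (y k) - G (γ k + s) (xb s)) atTop (𝓝 0) := by
      refine squeeze_zero_norm' ?_ (aux_classK_tendsto hω hy)
      filter_upwards [h2, hyK] with k hk hk2
      exact hωK _ hk _ hk2 _ (hxK s)
    simpa using h3.add (hlim _ (hKX (hxK s)) s hs)

lemma aux_comb_meas {N : ℕ} {V : Type*} [NormedAddCommGroup V] [NormedSpace ℝ V]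
    {u : ℝ → Fin N → ℝ} (hu : Measurable u) {g : Fin N → ℝ → V}
    (hg : ∀ i, AEStronglyMeasurable (g i) volume) :
    AEStronglyMeasurable (fun s => ∑ i, u s i • g i s) volume := by
  refine Finset.aestronglyMeasurable_fun_sum _ fun i _ => ?_
  exact ((measurable_pi_apply i).comp hu).aestronglyMeasurable.smul (hg i)

lemma aux_intervalIntegrable {V : Type*} [NormedAddCommGroup V]
    {g : ℝ → V} (hg : AEStronglyMeasurable g volume) {C : ℝ} (hC : ∀ᵐ s : ℝ, ‖g s‖ ≤ C)
    (a b : ℝ) : IntervalIntegrable g volume a b := by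
  refine (intervalIntegrable_const (c := C)).mono_fun' hg.restrict ?_
  exact ae_restrict_of_ae hC

/-- scalar weak convergence on an interval -/
lemma aux_weak_scalar {N : ℕ} {u : ℕ → ℝ → Fin N → ℝ} {v : ℝ → Fin N → ℝ} (hw : WeakConv u v)
    {g : Fin N → ℝ → ℝ} (hg : ∀ i, AEStronglyMeasurable (g i) volume) {C : ℝ}
    (hC : ∀ᵐ s : ℝ, ∀ i, ‖g i s‖ ≤ C) {a b : ℝ} (hab : a ≤ b) :
    Tendsto (fun k => ∫ s in a..b, ∑ i, u k s i • g i s) atTop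
      (𝓝 (∫ s in a..b, ∑ i, v s i • g i s)) := by
  have key : ∀ w : ℝ → Fin N → ℝ, ∫ s in a..b, ∑ i, w s i • g i s =
      ∫ s, ∑ i, (Ioc a b).indicator (g i) s * w s i := by
    intro w
    rw [intervalIntegral.integral_of_le hab, ← integral_indicator measurableSet_Ioc]
    congr 1; ext s
    by_cases hs : s ∈ Ioc a b <;> simp [hs, mul_comm]
  simp only [key]
  refine hw (fun s i => (Ioc a b).indicator (g i) s) (Integrable.of_eval fun i => ?_)
  rw [integrable_indicator_iff measurableSet_Ioc]
  have := aux_intervalIntegrable (hg i) (hC.mono fun s hs => hs i) a b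
  exact (intervalIntegrable_iff_integrableOn_Ioc_of_le hab).1 this

lemma aux_weak_vec {N n : ℕ} {u : ℕ → ℝ → Fin N → ℝ} {v : ℝ → Fin N → ℝ} (hw : WeakConv u v)
    (hum : ∀ k, Measurable (u k)) (hu : ∀ k t, u k t ∈ simplexU N) (hv : IsControl v)
    {g : Fin N → ℝ → E n} (hg : ∀ i, AEStronglyMeasurable (g i) volume) {C : ℝ}
    (hC : ∀ᵐ s : ℝ, ∀ i, ‖g i s‖ ≤ C) {a b : ℝ} (hab : a ≤ b) :
    Tendsto (fun k => ∫ s in a..b, ∑ i, u k s i • g i s) atTop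
      (𝓝 (∫ s in a..b, ∑ i, v s i • g i s)) := by
  have hInteg : ∀ w : ℝ → Fin N → ℝ, Measurable w → (∀ t, w t ∈ simplexU N) →
      IntervalIntegrable (fun s => ∑ i, w s i • g i s) volume a b := fun w hw1 hw2 =>
    aux_intervalIntegrable (aux_comb_meas hw1 hg)
      (hC.mono fun s hs => aux_simplex_norm (hw2 s) hs) a b
  have hcoord : ∀ (j : Fin n) (w : ℝ → Fin N → ℝ), Measurable w → (∀ t, w t ∈ simplexU N) →
      (∫ s in a..b, ∑ i, w s i • g i s) j = ∫ s in a..b, ∑ i, w s i • (g i s) j := by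
    intro j w hw1 hw2
    have := (EuclideanSpace.proj j : E n →L[ℝ] ℝ).intervalIntegral_comp_comm
      (hInteg w hw1 hw2)
    simpa using this.symm
  have hpi : Tendsto (fun k => WithLp.ofLp (∫ s in a..b, ∑ i, u k s i • g i s)) atTop
      (𝓝 (WithLp.ofLp (∫ s in a..b, ∑ i, v s i • g i s))) := by
    refine tendsto_pi_nhds.2 fun j => ?_
    rw [hcoord j v hv.1 hv.2]
    refine (aux_weak_scalar hw (g := fun i s => (g i s) j) (C := C)
      (fun i => ?_) ?_ hab).congr fun k => (hcoord j (u k) (hum k) (hu k)).symm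
    · exact (EuclideanSpace.proj j : E n →L[ℝ] ℝ).continuous.comp_aestronglyMeasurable (hg i)
    · filter_upwards [hC] with s hs i
      exact (PiLp.norm_apply_le (g i s) j).trans (hs i)
  exact ((PiLp.continuous_toLp 2 (fun _ : Fin n => ℝ)).tendsto _).comp hpi

lemma aux_weak_zero {N : ℕ} {u : ℕ → ℝ → Fin N → ℝ} {v : ℝ → Fin N → ℝ} (hw : WeakConv u v)
    (hum : ∀ k, Measurable (u k)) (hu : ∀ k t, u k t ∈ simplexU N) (hv : IsControl v)
    {g : Fin N → ℝ → ℝ} (hg0 : ∀ i s, 0 ≤ g i s)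
    (hg : ∀ i, AEStronglyMeasurable (g i) volume) {C : ℝ}
    (hC : ∀ᵐ s : ℝ, ∀ i, ‖g i s‖ ≤ C)
    (hz : ∀ᵐ s : ℝ, Tendsto (fun k => ∑ i, u k s i • g i s) atTop (𝓝 0)) :
    ∀ᵐ s : ℝ, ∑ i, v s i • g i s = 0 := by
  have hM : ∀ M : ℕ, ∀ᵐ s : ℝ, s ∈ Ioc (-(M:ℝ)) M → ∑ i, v s i • g i s = 0 := by
    intro M
    have hab : -(M:ℝ) ≤ M := by have : (0:ℝ) ≤ M := by positivity
                                linarith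
    have h1 := aux_weak_scalar hw hg hC hab
    have h2 : Tendsto (fun k => ∫ s in (-(M:ℝ))..M, ∑ i, u k s i • g i s) atTop
        (𝓝 (∫ s in (-(M:ℝ))..M, (0:ℝ))) := by
      refine intervalIntegral.tendsto_integral_filter_of_dominated_convergence (fun _ => C)
        (Eventually.of_forall fun k => (aux_comb_meas (hum k) hg).restrict)
        (Eventually.of_forall fun k => ?_) intervalIntegrable_const ?_
      · filter_upwards [hC] with s hs _
        exact aux_simplex_norm (hu k s) hs
      · filter_upwards [hz] with s hs _
        exact hs
    have h3 := tendsto_nhds_unique h1 h2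
    rw [intervalIntegral.integral_zero, intervalIntegral.integral_of_le hab] at h3
    have hInteg := aux_intervalIntegrable (aux_comb_meas hv.1 hg)
      (hC.mono fun s hs => aux_simplex_norm (hv.2 s) hs) (-(M:ℝ)) M
    rw [setIntegral_eq_zero_iff_of_nonneg_ae (f := fun s => ∑ i, v s i • g i s)
      (Eventually.of_forall fun s => Finset.sum_nonneg fun i _ =>
        mul_nonneg ((hv.2 s).1 i) (hg0 i s))
      ((intervalIntegrable_iff_integrableOn_Ioc_of_le hab).1 hInteg)] at h3
    exact (ae_restrict_iff' measurableSet_Ioc).1 h3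
  filter_upwards [ae_all_iff.2 hM] with s hs
  obtain ⟨M, hM⟩ := exists_nat_gt |s|
  exact hs M ⟨(abs_lt.1 hM).1, (abs_lt.1 hM).2.le⟩

lemma aux_ae_shift' {J' : Set ℝ} (hJ : volume (Ici (0:ℝ) \ J') = 0) (c : ℝ) :
    ∀ᵐ s : ℝ, 0 ≤ c + s → c + s ∈ J' := by
  have h1 : ∀ᵐ s : ℝ, c + s ∉ Ici (0:ℝ) \ J' :=
    (measurePreserving_add_left volume c).quasiMeasurePreserving.ae
      (p := fun s => s ∉ Ici (0:ℝ) \ J') (measure_eq_zero_iff_ae_notMem.1 hJ)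
  filter_upwards [h1] with s hs h0
  by_contra h
  exact hs ⟨h0, h⟩

lemma aux_subseq {ι : Type*} [Fintype ι] (P : ι → (ℕ → ℝ) → Prop)
    (hsub : ∀ i t (φ : ℕ → ℕ), StrictMono φ → P i t → P i (t ∘ φ))
    (hex : ∀ i t, Tendsto t atTop atTop → ∃ φ : ℕ → ℕ, StrictMono φ ∧ P i (t ∘ φ))
    (t : ℕ → ℝ) (ht : Tendsto t atTop atTop) :
    ∃ φ : ℕ → ℕ, StrictMono φ ∧ ∀ i, P i (t ∘ φ) := by
  classical
  have key : ∀ s : Finset ι, ∃ φ : ℕ → ℕ, StrictMono φ ∧ ∀ i ∈ s, P i (t ∘ φ) := by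
    intro s
    induction s using Finset.induction_on with
    | empty => exact ⟨id, strictMono_id, by simp⟩
    | insert a s ha ih =>
      obtain ⟨φ, hφ, hP⟩ := ih
      obtain ⟨ψ, hψ, hQ⟩ := hex a (t ∘ φ) (ht.comp hφ.tendsto_atTop)
      refine ⟨φ ∘ ψ, hφ.comp hψ, fun i hi => ?_⟩
      rcases Finset.mem_insert.1 hi with rfl | hi
      · exact hQ
      · exact hsub i _ ψ hψ (hP i hi)
  obtain ⟨φ, hφ, hP⟩ := key Finset.univ
  exact ⟨φ, hφ, fun i => hP i (Finset.mem_univ i)⟩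

lemma aux_admissible_sub {X F : Type*} [TopologicalSpace F]
    {𝒳 : Set X} {g : ℝ → X → F} (t : ℕ → ℝ) (φ : ℕ → ℕ) (hφ : StrictMono φ)
    (h : Admissible 𝒳 g t) : Admissible 𝒳 g (t ∘ φ) := by
  obtain ⟨h1, gl, Z, hZ, hl⟩ := h
  exact ⟨h1.comp hφ.tendsto_atTop, gl, Z, hZ, fun ξ hξ s hs =>
    (hl ξ hξ s hs).comp hφ.tendsto_atTop⟩

lemma aux_sel {N : ℕ} {V : Type*} [NormedAddCommGroup V] (d : Fin N → ℕ → V)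
    (hd : ∀ i, Tendsto (d i) atTop (𝓝 0)) (σ : ℕ → Fin N) :
    Tendsto (fun k => d (σ k) k) atTop (𝓝 0) := by
  have h1 : Tendsto (fun k => ∑ i, ‖d i k‖) atTop (𝓝 0) := by
    have := tendsto_finsetSum (Finset.univ : Finset (Fin N)) fun i _ => (hd i).norm
    simpa using this
  exact squeeze_zero_norm (fun k => Finset.single_le_sum (f := fun i => ‖d i k‖)
    (fun i _ => norm_nonneg _) (Finset.mem_univ (σ k))) h1

lemma aux_zeroing {n N : ℕ} {F G : Type*} [NormedAddCommGroup F] [NormedAddCommGroup G]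
    {𝒳 K : Set (E n)} {h : ℝ → E n → Fin N → F} {D : ℝ → E n → Fin N → G}
    (hzp : ∀ i, ZeroingPair 𝒳 (fun t ξ => h t ξ i) fun t ξ => D t ξ i)
    (hK : IsCompact K) (hKX : K ⊆ 𝒳) {ε : ℝ} (hε : 0 < ε)
    {t : ℕ → ℝ} (ht : Tendsto t atTop atTop) {v : ℕ → E n} {σ : ℕ → Fin N}
    (hv : ∀ᶠ k in atTop, v k ∈ K ∧ ε ≤ ‖v k‖)
    (hh : Tendsto (fun k => h (t k) (v k) (σ k)) atTop (𝓝 0)) :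
    Tendsto (fun k => D (t k) (v k) (σ k)) atTop (𝓝 0) := by
  refine tendsto_of_subseq_tendsto fun ns hns => ?_
  have h1 : ∃ i, ∃ᶠ k in atTop, σ (ns k) = i := by
    by_contra hcon
    push Not at hcon
    have := eventually_all.2 hcon
    obtain ⟨k, hk⟩ := this.exists
    exact hk _ rfl
  obtain ⟨i, hi⟩ := h1
  obtain ⟨ms, hms, hP⟩ := extraction_of_frequently_atTop (hi.and_eventually (hns.eventually hv))
  refine ⟨ms, ?_⟩
  have hlim : Tendsto (fun k => ns (ms k)) atTop atTop := hns.comp hms.tendsto_atTop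
  have := hzp i (fun k => t (ns (ms k))) (ht.comp hlim) K hK hKX ε hε (fun k => v (ns (ms k)))
    (fun k => (hP k).2.1) (fun k => (hP k).2.2)
    ((hh.comp hlim).congr fun k => by simp only [Function.comp, (hP k).1])
  exact this.congr fun k => by simp only [(hP k).1]

lemma aux_Uset {n N : ℕ} {χ : Fin N → Set (E n)} {ξ : E n} {μ : Fin N → ℝ}
    (hμ : μ ∈ simplexU N) (h0 : ∀ i, ξ ∉ χ i → μ i = 0) : μ ∈ Uset χ ξ := by
  classical
  have h1 : ∑ i ∈ Finset.univ.filter (fun i => ξ ∈ χ i), μ i = 1 := by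
    rw [← hμ.2]
    refine Finset.sum_subset (Finset.subset_univ _) fun i _ hi => h0 i ?_
    simpa using hi
  have h2 : ∑ i ∈ Finset.univ.filter (fun i => ξ ∈ χ i), μ i • stdVec N i = μ := by
    have : ∑ i, μ i • stdVec N i = μ := by
      ext j
      simp [stdVec]
    conv_rhs => rw [← this]
    refine Finset.sum_subset (Finset.subset_univ _) fun i _ hi => ?_
    rw [h0 i (by simpa using hi), zero_smul]
  rw [← h2]
  refine (convex_convexHull ℝ _).sum_mem (fun i _ => hμ.1 i) h1 fun i hi => ?_
  exact subset_convexHull ℝ _ ⟨i, by simpa using hi, rfl⟩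

/-- Theorem 2: every 𝒯-zeroing-output limiting trajectory is a bounded complete
trajectory of some reduced limiting control system Σ_γ with γ ∈ Λ. -/
theorem zeroing_limiting_trajectory_solves_reduced_system
    {n N p : ℕ} (𝒳 : Set (E n)) (hXopen : IsOpen 𝒳) (hX0 : (0 : E n) ∈ 𝒳)
    (f fhat Δf : ℝ → E n → Fin N → E n)
    (h : ℝ → E n → Fin N → EuclideanSpace ℝ (Fin p))
    (hdecomp : ∀ t ξ i, f t ξ i = fhat t ξ i + Δf t ξ i)
    (hf_car : ∀ i, Caratheodory 𝒳 fun t ξ => f t ξ i)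
    -- Assumption 2: each f_i is uniformly bounded
    (hf_bdd : ∀ i, UnifBounded 𝒳 fun t ξ => f t ξ i)
    -- Assumption 3, part 1): regularity of the output maps h_i
    (hh_bdd : ∀ i, UnifBounded 𝒳 fun t ξ => h t ξ i)
    (hh_meas : ∀ i, ∀ ξ ∈ 𝒳, Measurable fun t => h t ξ i)
    (hh_cont : ∀ i, ContXiUnifT 𝒳 fun t ξ => h t ξ i)
    (hh_pre : ∀ i, Precompact 𝒳 fun t ξ => h t ξ i)
    -- Assumption 3, part 2a): regularity of the maps f̂_i
    (hfhat_bdd : ∀ i, UnifBounded 𝒳 fun t ξ => fhat t ξ i)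
    (hfhat_meas : ∀ i, ∀ ξ ∈ 𝒳, Measurable fun t => fhat t ξ i)
    (hfhat_cont : ∀ i, ContXiUnifT 𝒳 fun t ξ => fhat t ξ i)
    (hfhat_pre : ∀ i, Precompact 𝒳 fun t ξ => fhat t ξ i)
    -- Assumption 3, part 2b): (h_i, Δf_i) is a zeroing pair
    (hzp : ∀ i, ZeroingPair 𝒳 (fun t ξ => h t ξ i) fun t ξ => Δf t ξ i)
    -- the family of trajectories and the covering
    (𝒯 : Set (Sol 𝒳 f)) (hmax : ∀ T ∈ 𝒯, T.IsMaximal)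
    (χ : Fin N → Set (E n)) (hχ_closed : ∀ i, IsClosed (χ i))
    (hχ_cover : (⋃ i, χ i) = Set.univ) (hinv : InvariantWrt 𝒯 χ)
    (xb : ℝ → E n) (ub : ℝ → Fin N → ℝ)
    (hzlt : ZeroingOutputLimitingTrajectory 𝒯 h xb ub) :
    ∃ γ : ℕ → ℝ, Tendsto γ atTop atTop ∧
      ∃ (fl : Fin N → ℝ → E n → E n)
        (hlm : Fin N → ℝ → E n → EuclideanSpace ℝ (Fin p)),
        (∀ i, IsLimitAlong 𝒳 (fun t ξ => fhat t ξ i) γ (fl i)) ∧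
        (∀ i, IsLimitAlong 𝒳 (fun t ξ => h t ξ i) γ (hlm i)) ∧
        BoundedRange 𝒳 xb ∧ CompleteTrajOf 𝒯 χ fl hlm xb ub := by
  obtain ⟨hxc, hxX, hub, t, T, ⟨ht, hT, hdom, ⟨K, hK, hKX, ε, hε, hTK⟩, hout⟩, hunif, hweak⟩ := hzlt
  -- choice of the subsequence
  obtain ⟨φ, hφ, hadm⟩ := aux_subseq
    (fun i τ => Admissible 𝒳 (fun t ξ => fhat t ξ i) τ)
    (fun i τ ψ hψ h1 => aux_admissible_sub τ ψ hψ h1) (fun i => hfhat_pre i) t ht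
  obtain ⟨ψ, hψ, hadm2⟩ := aux_subseq
    (fun i τ => Admissible 𝒳 (fun t ξ => h t ξ i) τ)
    (fun i τ ψ hψ h1 => aux_admissible_sub τ ψ hψ h1) (fun i => hh_pre i) (t ∘ φ)
    (ht.comp hφ.tendsto_atTop)
  have hadm1 : ∀ i, Admissible 𝒳 (fun t ξ => fhat t ξ i) ((t ∘ φ) ∘ ψ) :=
    fun i => aux_admissible_sub _ ψ hψ (hadm i)
  choose hγ' fl hfl using hadm1
  choose hγ'' hl hhl using hadm2
  let θ : ℕ → ℕ := fun k => φ (ψ k)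
  have hθ : StrictMono θ := hφ.comp hψ
  let γ : ℕ → ℝ := fun k => t (θ k)
  have hγ : Tendsto γ atTop atTop := ht.comp hθ.tendsto_atTop
  have hfl : ∀ i, IsLimitAlong 𝒳 (fun t ξ => fhat t ξ i) γ (fl i) := hfl
  have hhl : ∀ i, IsLimitAlong 𝒳 (fun t ξ => h t ξ i) γ (hl i) := hhl
  let X : ℕ → ℝ → E n := fun k s => (T (θ k)).x (γ k + s)
  let S : ℕ → ℝ → Fin N := fun k s => (T (θ k)).σ (γ k + s)
  let U : ℕ → ℝ → Fin N → ℝ := fun k s => ctrlOfSwitch (T (θ k)).σ (γ k + s)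
  have hle : ∀ k : ℕ, (k : ℝ) ≤ (θ k : ℝ) := fun k => by exact_mod_cast hθ.id_le k
  have hXK : ∀ k : ℕ, ∀ s : ℝ, |s| ≤ (k : ℝ) → X k s ∈ K ∧ ε ≤ ‖X k s‖ :=
    fun k s hs => hTK (θ k) s (hs.trans (hle k))
  have hsk : ∀ s : ℝ, ∀ᶠ k : ℕ in atTop, |s| ≤ (k : ℝ) := fun s =>
    tendsto_natCast_atTop_atTop.eventually_ge_atTop |s|
  have hdomθ : ∀ k : ℕ, ∀ s : ℝ, |s| ≤ (k : ℝ) →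
      (T (θ k)).t0 ≤ γ k + s ∧ ((γ k + s : ℝ) : EReal) < (T (θ k)).tf := by
    intro k s hs
    have h1 := hdom (θ k)
    have h2 := hle k
    have h3 := abs_le.1 hs
    refine ⟨?_, lt_of_le_of_lt (EReal.coe_le_coe_iff.2 ?_) h1.2⟩
    · have := h1.1
      change _ ≤ t (θ k) + s
      linarith
    · change t (θ k) + s ≤ _
      linarith
  have hXlim : ∀ s, Tendsto (fun k => X k s) atTop (𝓝 (xb s)) := by
    intro s
    have h1 := (hunif (|s| + 1) (by positivity)).tendsto_at (x := s)
      ⟨by linarith [neg_abs_le s], by linarith [le_abs_self s]⟩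
    exact h1.comp hθ.tendsto_atTop
  have hxK : ∀ s, xb s ∈ K := fun s =>
    hK.isClosed.mem_of_tendsto (hXlim s) ((hsk s).mono fun k hk => (hXK k s hk).1)
  have hw : WeakConv U ub := fun g hg => (hweak g hg).comp hθ.tendsto_atTop
  have hUm : ∀ k, Measurable (U k) := fun k => aux_ctrl_measurable (T (θ k)).switching (γ k)
  have hUs : ∀ k s, U k s ∈ simplexU N := fun k s => aux_ctrl_simplex _ _
  have houtθ : ∀ᵐ s : ℝ, Tendsto (fun k => h (γ k + s) (X k s) (S k s)) atTop (𝓝 0) := by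
    filter_upwards [hout] with s hs
    exact hs.comp hθ.tendsto_atTop
  -- limits along the trajectory
  have Lf := fun i => aux_limit hK hKX (hfhat_bdd i) (hfhat_meas i) (hfhat_cont i) hγ (hfl i)
    hxc hxK
  have Lh := fun i => aux_limit hK hKX (hh_bdd i) (hh_meas i) (hh_cont i) hγ (hhl i) hxc hxK
  have hflim : ∀ᵐ s : ℝ, ∀ i, Tendsto (fun k => fhat (γ k + s) (X k s) i) atTop
      (𝓝 (fl i s (xb s))) := by
    filter_upwards [ae_all_iff.2 fun i => (Lf i).2.2] with s hs i
    exact hs i _ ((hsk s).mono fun k hk => (hXK k s hk).1) (hXlim s)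
  have hhlim : ∀ᵐ s : ℝ, ∀ i, Tendsto (fun k => h (γ k + s) (X k s) i) atTop
      (𝓝 (hl i s (xb s))) := by
    filter_upwards [ae_all_iff.2 fun i => (Lh i).2.2] with s hs i
    exact hs i _ ((hsk s).mono fun k hk => (hXK k s hk).1) (hXlim s)
  choose Cf hCf using fun i => (Lf i).2.1
  choose Ch hCh using fun i => (Lh i).2.1
  obtain ⟨C1, hC1⟩ := Finite.exists_le Cf
  obtain ⟨C2, hC2⟩ := Finite.exists_le Ch
  have hCf' : ∀ᵐ s : ℝ, ∀ i, ‖fl i s (xb s)‖ ≤ C1 := by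
    filter_upwards [ae_all_iff.2 hCf] with s hs i
    exact (hs i).trans (hC1 i)
  have hCh' : ∀ᵐ s : ℝ, ∀ i, ‖‖hl i s (xb s)‖‖ ≤ C2 := by
    filter_upwards [ae_all_iff.2 hCh] with s hs i
    rw [norm_norm]
    exact (hs i).trans (hC2 i)
  have hΔ : ∀ᵐ s : ℝ, Tendsto (fun k => Δf (γ k + s) (X k s) (S k s)) atTop (𝓝 0) := by
    filter_upwards [houtθ] with s hs
    exact aux_zeroing hzp hK hKX hε (tendsto_atTop_add_const_right _ s hγ)
      ((hsk s).mono fun k hk => hXK k s hk) hs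
  -- output equation
  have hzero : ∀ᵐ s : ℝ, ∑ i, ub s i • ‖hl i s (xb s)‖ = 0 := by
    refine aux_weak_zero hw hUm hUs hub (g := fun i s => ‖hl i s (xb s)‖)
      (fun i s => norm_nonneg _) (fun i => (Lh i).1.norm) hCh' ?_
    filter_upwards [houtθ, hhlim] with s hs1 hs2
    have h1 := aux_sel (fun i k => h (γ k + s) (X k s) i - hl i s (xb s))
      (fun i => by simpa using (hs2 i).sub_const (hl i s (xb s))) (fun k => S k s)
    have h2 : Tendsto (fun k => ‖hl (S k s) s (xb s)‖) atTop (𝓝 0) := by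
      simpa using (hs1.sub h1).norm
    refine h2.congr fun k => ?_
    exact (aux_ctrl_sum _ _ (fun i => ‖hl i s (xb s)‖)).symm
  -- covering constraint
  have hcov : ∀ᵐ s : ℝ, ub s ∈ Uset χ (xb s) := by
    have hz : ∀ᵐ s : ℝ, ∑ i, ub s i • ({r | xb r ∉ χ i}.indicator (fun _ => (1:ℝ)) s) = 0 := by
      refine aux_weak_zero hw hUm hUs hub
        (g := fun i s => {r | xb r ∉ χ i}.indicator (fun _ => (1:ℝ)) s) (C := 1)
        (fun i s => indicator_nonneg (fun _ _ => zero_le_one) _) (fun i => ?_) ?_ ?_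
      · have ho : MeasurableSet {r | xb r ∉ χ i} :=
          ((hχ_closed i).isOpen_compl.preimage hxc).measurableSet
        exact (measurable_const.indicator ho).aestronglyMeasurable
      · refine Eventually.of_forall fun s i => ?_
        refine (norm_indicator_le_norm_self _ _).trans (by simp)
      · refine Eventually.of_forall fun s => ?_
        have h1 : ∀ᶠ k in atTop, ∀ i, xb s ∉ χ i → X k s ∉ χ i := by
          refine eventually_all.2 fun i => ?_
          by_cases hi : xb s ∈ χ i
          · exact Eventually.of_forall fun k h => absurd hi h
          · filter_upwards [(hXlim s).eventually ((hχ_closed i).isOpen_compl.mem_nhds hi)]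
              with k hk _
            exact hk
        refine tendsto_const_nhds.congr' ?_
        filter_upwards [h1, hsk s] with k hk hk2
        have h3 : X k s ∈ χ (S k s) := hinv _ (hT (θ k)) _ (hdomθ k s hk2)
        have h4 : xb s ∈ χ (S k s) := by
          by_contra hcon
          exact hk _ hcon h3
        refine Eq.trans ?_ (aux_ctrl_sum _ _
          (fun i => {r | xb r ∉ χ i}.indicator (fun _ => (1:ℝ)) s)).symm
        have h5 : s ∉ {r | xb r ∉ χ (S k s)} := fun hcon => hcon h4
        exact (indicator_of_notMem h5 _).symm
    filter_upwards [hz] with s hs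
    refine aux_Uset (hub.2 s) fun i hi => ?_
    have h1 := (Finset.sum_eq_zero_iff_of_nonneg (fun i _ => mul_nonneg ((hub.2 s).1 i)
      (indicator_nonneg (s := {r | xb r ∉ χ i}) (f := fun _ => (1:ℝ))
        (fun _ _ => zero_le_one) s))).1 hs i (Finset.mem_univ i)
    simpa [indicator_of_mem (show s ∈ {r | xb r ∉ χ i} from hi)] using h1
  -- integral equation
  let w : ℝ → E n := fun s => ∑ i, ub s i • fl i s (xb s)
  have hwm : AEStronglyMeasurable w volume := aux_comb_meas hub.1 fun i => (Lf i).1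
  have hwb : ∀ᵐ s : ℝ, ‖w s‖ ≤ C1 := hCf'.mono fun s hs => aux_simplex_norm (hub.2 s) hs
  have hwint : ∀ a b, IntervalIntegrable w volume a b := aux_intervalIntegrable hwm hwb
  have hinteq : ∀ a b : ℝ, a ≤ b → xb b = xb a + ∫ s in a..b, w s := by
    intro a b hab
    choose J hJ0 hJ hJb using hf_bdd
    choose CF hCF using fun i => hJb i K hK hKX
    obtain ⟨C3, hC3⟩ := Finite.exists_le CF
    let Fk : ℕ → ℝ → E n := fun k s => f (γ k + s) (X k s) (S k s)
    let V : ℕ → ℝ → E n := fun k s => ∑ i, U k s i • fl i s (xb s)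
    have hVm : ∀ k, AEStronglyMeasurable (V k) volume := fun k =>
      aux_comb_meas (hUm k) fun i => (Lf i).1
    have hVb : ∀ k, ∀ᵐ s : ℝ, ‖V k s‖ ≤ C1 := fun k =>
      hCf'.mono fun s hs => aux_simplex_norm (hUs k s) hs
    have hFint : ∀ᶠ k in atTop, IntervalIntegrable (Fk k) volume a b := by
      filter_upwards [hsk a, hsk b] with k ha hb
      have h1 := (T (θ k)).intg (γ k + a) (γ k + b) (hdomθ k a ha).1 (by linarith)
        (hdomθ k b hb).2
      have h2 := h1.comp_add_left (γ k)
      simpa using h2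
    have hFeq : ∀ᶠ k in atTop, ∫ s in a..b, Fk k s = X k b - X k a := by
      filter_upwards [hsk a, hsk b] with k ha hb
      have h1 := (T (θ k)).sol (γ k + a) (γ k + b) (hdomθ k a ha).1 (by linarith)
        (hdomθ k b hb).2
      have h2 := intervalIntegral.integral_comp_add_left (a := a) (b := b)
        (fun τ => f τ ((T (θ k)).x τ) ((T (θ k)).σ τ)) (γ k)
      change ∫ s in a..b, f (γ k + s) ((T (θ k)).x (γ k + s)) ((T (θ k)).σ (γ k + s))
        = (T (θ k)).x (γ k + b) - (T (θ k)).x (γ k + a)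
      rw [h2, h1]
      abel
    have hR : Tendsto (fun k => ∫ s in a..b, (Fk k s - V k s)) atTop
        (𝓝 (∫ s in a..b, (0 : E n))) := by
      refine intervalIntegral.tendsto_integral_filter_of_dominated_convergence
        (fun _ => C3 + C1) ?_ ?_ intervalIntegrable_const ?_
      · filter_upwards [hFint] with k hk
        exact hk.aestronglyMeasurable_restrict_uIoc.sub (hVm k).restrict
      · filter_upwards [hsk a, hsk b] with k ha hb
        filter_upwards [hVb k, ae_all_iff.2 fun i => aux_ae_shift' (hJ i) (γ k)] with s h1 h2 hs
        rw [uIoc_of_le hab] at hs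
        have hsk : |s| ≤ (k:ℝ) := abs_le.2 ⟨by linarith [(abs_le.1 ha).1, hs.1],
          by linarith [(abs_le.1 hb).2, hs.2]⟩
        have h3 : 0 ≤ γ k + s := (T (θ k)).t0_nonneg.trans (hdomθ k s hsk).1
        refine (norm_sub_le _ _).trans (add_le_add ?_ h1)
        exact (hCF (S k s) _ (h2 _ h3) _ (hXK k s hsk).1).trans (hC3 _)
      · filter_upwards [hΔ, hflim] with s hs1 hs2 _
        have h1 := aux_sel (fun i k => fhat (γ k + s) (X k s) i - fl i s (xb s))
          (fun i => by simpa using (hs2 i).sub_const (fl i s (xb s))) (fun k => S k s)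
        have h2 := h1.add hs1
        rw [add_zero] at h2
        refine h2.congr fun k => ?_
        have h3 : V k s = fl (S k s) s (xb s) := aux_ctrl_sum _ _ (fun i => fl i s (xb s))
        simp only [Fk, h3, hdecomp]
        abel
    have hV := aux_weak_vec hw hUm hUs hub (g := fun i s => fl i s (xb s))
      (fun i => (Lf i).1) hCf' hab
    have h1 := hR.add hV
    rw [intervalIntegral.integral_zero, zero_add] at h1
    have h2 : Tendsto (fun k => X k b - X k a) atTop (𝓝 (xb b - xb a)) :=
      (hXlim b).sub (hXlim a)
    have h3 := tendsto_nhds_unique h2 (h1.congr' (by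
      filter_upwards [hFint, hFeq] with k hk1 hk2
      rw [← hk2, intervalIntegral.integral_sub hk1
        (aux_intervalIntegrable (hVm k) (hVb k) a b)]
      exact sub_add_cancel _ _))
    change xb b = xb a + ∫ s in a..b, ∑ i, ub s i • fl i s (xb s)
    rw [← h3]
    abel
  have hac : ∀ r, xb r = xb 0 + ∫ s in (0:ℝ)..r, w s := by
    intro r
    rcases le_total 0 r with hr | hr
    · exact hinteq 0 r hr
    · rw [hinteq r 0 hr, intervalIntegral.integral_symm r 0]
      abel
  have hder : ∀ᵐ s : ℝ, HasDerivAt xb (w s) s := by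
    have hloc : LocallyIntegrable w volume := by
      rw [locallyIntegrable_iff]
      intro Q hQ
      refine Measure.integrableOn_of_bounded (M := C1) hQ.measure_ne_top hwm ?_
      exact ae_restrict_of_ae hwb
    filter_upwards [_root_.LocallyIntegrable.ae_hasDerivAt_integral hloc] with s hs
    have h1 := (hs 0).const_add (xb 0)
    have h2 : xb = fun r => xb 0 + ∫ s in (0:ℝ)..r, w s := funext hac
    rw [h2]
    exact h1
  refine ⟨γ, hγ, fl, hl, hfl, hhl, ⟨K, hK, hKX, hxK⟩, hxX, ⟨w, hwint, hac⟩,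
    ⟨hub, t, T, ht, hT, hweak⟩, ?_⟩
  filter_upwards [hcov, hder, hzero] with s h1 h2 h3
  exact ⟨h1, h2, h3⟩
end
end

section
/- Suppose f and h satisfy: (A2) each f_i is uniformly bounded; (A3) for each i ∈ I, h_i is uniformly bounded, measurable in t, continuous in ξ uniformly in t, and precompact, and f_i = f̂_i + Δf_i with f̂_i uniformly bounded, measurable in t, continuous in ξ uniformly in t, and precompact, and (h_i, Δf_i) a zeroing pair. Let 𝒯 be a family of trajectories of ẋ = f(t,x,σ(t)) with output y = h(t,x,σ(t)) that is invariant w.r.t. a closed covering χ of ℝ^n. If for every γ ∈ Λ := ∩_{i∈I}[Λ(f̂_i) ∩ Λ(h_i)] the reduced limiting control system Σ_γ is WZSD (i.e., every bounded complete trajectory (x,u) of Σ_γ satisfies inf_{t∈ℝ} |x(t)| = 0), then the pair (h,f) is weakly zero-state detectable with respect to 𝒯, i.e., no 𝒯-zeroing-output sequence exists. -/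
open MeasureTheory Filter Set Topology

noncomputable section

namespace SwitchedSys

variable {n N : ℕ} {𝒳 : Set (E n)} {f : ℝ → E n → Fin N → E n}

/-! ### Auxiliary lemmas -/

theorem exists_subseq_lip {F : Type*} [NormedAddCommGroup F] [ProperSpace F] (C : NNReal)
    (y : ℕ → ℝ → F) (hL : ∀ k, LipschitzWith C (y k)) (R : ℝ) (h0 : ∀ k, ‖y k 0‖ ≤ R) :
    ∃ φ : ℕ → ℕ, StrictMono φ ∧ ∃ z : ℝ → F, LipschitzWith C z ∧
      ∀ s, Tendsto (fun k => y (φ k) s) atTop (𝓝 (z s)) := by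
  have hcomp : IsCompact (Set.pi univ (fun q : ℚ => Metric.closedBall (0:F) (R + C * |(q:ℝ)|))) :=
    isCompact_univ_pi fun q => isCompact_closedBall _ _
  obtain ⟨a, -, φ, hφ, ha⟩ := hcomp.isSeqCompact (x := fun k (q : ℚ) => y k q) (by
    intro k q _
    rw [mem_closedBall_zero_iff]
    have h1 := (hL k).dist_le_mul q 0
    rw [dist_eq_norm, Real.dist_eq, sub_zero] at h1
    have h2 := norm_le_norm_add_norm_sub' (y k q) (y k 0)
    have := h0 k
    linarith)
  rw [tendsto_pi_nhds] at ha
  have hc : ∀ s : ℝ, CauchySeq (fun k => y (φ k) s) := by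
    intro s
    rw [Metric.cauchySeq_iff']
    intro ε hε
    obtain ⟨q, hq1, hq2⟩ := exists_rat_btwn (show s < s + ε / 4 / (C + 1) by
      have : 0 < ε / 4 / ((C:ℝ) + 1) := by positivity
      linarith)
    have hb : (C:ℝ) * |s - q| ≤ ε / 4 := by
      have hC : (0:ℝ) ≤ C := C.2
      have h3 : |s - q| ≤ ε / 4 / (C + 1) := by
        rw [abs_le]; constructor <;> linarith
      have h4 : ε / 4 / ((C:ℝ) + 1) * (C + 1) = ε / 4 := by field_simp
      nlinarith [abs_nonneg (s - q)]
    obtain ⟨M, hM⟩ := Metric.cauchySeq_iff'.1 (ha q).cauchySeq (ε / 4) (by positivity)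
    refine ⟨M, fun k hk => ?_⟩
    have h1 := (hL (φ k)).dist_le_mul s q
    have h2 := (hL (φ M)).dist_le_mul s q
    have h3 := hM k hk
    rw [Real.dist_eq] at h1 h2
    simp only [Function.comp] at h3
    have h4 := dist_triangle4 (y (φ k) s) (y (φ k) q) (y (φ M) q) (y (φ M) s)
    rw [dist_comm (y (φ M) q)] at h4
    linarith
  choose z hz using fun s => cauchySeq_tendsto_of_complete (hc s)
  refine ⟨φ, hφ, z, ?_, hz⟩
  refine LipschitzWith.of_dist_le_mul fun s r => ?_
  exact le_of_tendsto ((hz s).dist (hz r)) (Eventually.of_forall fun k => (hL _).dist_le_mul s r)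

theorem tendsto_integral_mul_closed {d : ℕ → ℝ → ℝ} (hdm : ∀ k, Measurable (d k))
    (hd : ∀ k s, |d k s| ≤ 2) {g : ℝ → ℝ} (hg : Integrable g volume)
    (H : ∀ ε > 0, ∃ g' : ℝ → ℝ, Integrable g' volume ∧ ∫ s, ‖g s - g' s‖ ≤ ε ∧
      Tendsto (fun k => ∫ s, g' s * d k s) atTop (𝓝 0)) :
    Tendsto (fun k => ∫ s, g s * d k s) atTop (𝓝 0) := by
  rw [Metric.tendsto_atTop]
  intro ε hε
  obtain ⟨g', hg', h1, h2⟩ := H (ε / 4) (by positivity)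
  obtain ⟨M, hM⟩ := Metric.tendsto_atTop.1 h2 (ε / 2) (by positivity)
  refine ⟨M, fun k hk => ?_⟩
  have h3 := hM k hk
  rw [dist_zero_right] at h3 ⊢
  have i1 : ∀ {g : ℝ → ℝ}, Integrable g volume → Integrable (fun s => g s * d k s) volume :=
    fun hg => hg.mul_bdd (c := 2) (hdm k).aestronglyMeasurable (Eventually.of_forall (hd k))
  have h4 : ∫ s, g s * d k s = (∫ s, g' s * d k s) + ∫ s, (g s - g' s) * d k s := by
    have := integral_add (i1 hg') (i1 (hg.sub hg'))
    simp only [Pi.sub_apply] at this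
    rw [← this]
    congr 1; ext s; ring
  have h5 : ‖∫ s, (g s - g' s) * d k s‖ ≤ ∫ s, ‖g s - g' s‖ * 2 := by
    refine norm_integral_le_of_norm_le ((hg.sub hg').norm.mul_const 2)
      (Eventually.of_forall fun s => ?_)
    rw [norm_mul]
    exact mul_le_mul_of_nonneg_left (hd k s) (norm_nonneg _)
  rw [integral_mul_const] at h5
  rw [h4]
  have := norm_add_le (∫ s, g' s * d k s) (∫ s, (g s - g' s) * d k s)
  linarith

theorem tendsto_setIntegral_of_intervals {d : ℕ → ℝ → ℝ} (hdm : ∀ k, Measurable (d k))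
    (hd : ∀ k s, |d k s| ≤ 2)
    (H : ∀ a b : ℝ, Tendsto (fun k => ∫ s in a..b, d k s) atTop (𝓝 0)) (m : ℝ) (hm : 0 ≤ m)
    (S : Set ℝ) (hS : MeasurableSet S) :
    Tendsto (fun k => ∫ s in S ∩ Ioc (-m) m, d k s) atTop (𝓝 0) := by
  have hintegr : ∀ k, IntegrableOn (d k) (Ioc (-m) m) volume := fun k =>
    Measure.integrableOn_of_bounded (M := 2) (by simp) (hdm k).aestronglyMeasurable
      (Eventually.of_forall (hd k))
  have hI : Tendsto (fun k => ∫ s in Ioc (-m) m, d k s) atTop (𝓝 0) := by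
    have := H (-m) m
    simpa [intervalIntegral.integral_of_le (show -m ≤ m by linarith)] using this
  induction S, hS using MeasurableSpace.induction_on_inter (borel_eq_generateFrom_Iic ℝ)
    isPiSystem_Iic with
  | empty => simp
  | basic t ht =>
    obtain ⟨a, rfl⟩ := ht
    have he : Iic a ∩ Ioc (-m) m = Ioc (-m) (min a m) := by
      ext s; simp only [mem_inter_iff, mem_Iic, mem_Ioc, le_min_iff]; tauto
    rw [he]
    by_cases ham : -m ≤ min a m
    · have := H (-m) (min a m)
      simpa [intervalIntegral.integral_of_le ham] using this
    · rw [Ioc_eq_empty (by intro h; exact ham h.le)]; simp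
  | compl t ht ih =>
    have : ∀ k, ∫ s in tᶜ ∩ Ioc (-m) m, d k s =
        (∫ s in Ioc (-m) m, d k s) - ∫ s in t ∩ Ioc (-m) m, d k s := by
      intro k
      have h := integral_inter_add_sdiff (μ := volume) (f := d k) (s := Ioc (-m) m) ht (hintegr k)
      rw [inter_comm t, ← h]
      have : tᶜ ∩ Ioc (-m) m = Ioc (-m) m \ t := by rw [inter_comm]; rfl
      rw [this]; ring
    simp_rw [this]
    simpa using hI.sub ih
  | iUnion f hf hfm ih =>
    have hdisj : Pairwise (Function.onFun Disjoint fun j => f j ∩ Ioc (-m) m) := fun i j hij =>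
      (hf hij).mono inter_subset_left inter_subset_left
    have hmeas : ∀ j, MeasurableSet (f j ∩ Ioc (-m) m) := fun j => (hfm j).inter measurableSet_Ioc
    have hsub : (⋃ j, f j ∩ Ioc (-m) m) ⊆ Ioc (-m) m := iUnion_subset fun j => inter_subset_right
    have : ∀ k, ∫ s in (⋃ j, f j) ∩ Ioc (-m) m, d k s = ∑' j, ∫ s in f j ∩ Ioc (-m) m, d k s := by
      intro k
      rw [iUnion_inter, integral_iUnion hmeas hdisj ((hintegr k).mono_set hsub)]
    simp_rw [this]
    have hsum : Summable fun j => 2 * volume.real (f j ∩ Ioc (-m) m) := by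
      refine Summable.mul_left _ ?_
      refine ENNReal.summable_toReal ?_
      rw [← measure_iUnion hdisj hmeas]
      exact ((measure_mono hsub).trans_lt (by simp)).ne
    have h0 : (0:ℝ) = ∑' j : ℕ, (0:ℝ) := by simp
    rw [h0]
    refine tendsto_tsum_of_dominated_convergence hsum ih (Eventually.of_forall fun k j => ?_)
    exact norm_setIntegral_le_of_norm_le_const
      ((measure_mono inter_subset_right).trans_lt (by simp)) (fun s _ => hd k s)

theorem tendsto_integral_mul_of_intervals {d : ℕ → ℝ → ℝ} (hdm : ∀ k, Measurable (d k))
    (hd : ∀ k s, |d k s| ≤ 2)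
    (H : ∀ a b : ℝ, Tendsto (fun k => ∫ s in a..b, d k s) atTop (𝓝 0))
    {g : ℝ → ℝ} (hg : Integrable g volume) :
    Tendsto (fun k => ∫ s, g s * d k s) atTop (𝓝 0) := by
  have i1 : ∀ k, ∀ {g : ℝ → ℝ}, Integrable g volume →
      Integrable (fun s => g s * d k s) volume :=
    fun k _ hg => hg.mul_bdd (c := 2) (hdm k).aestronglyMeasurable (Eventually.of_forall (hd k))
  refine Integrable.induction (P := fun g => Tendsto (fun k => ∫ s, g s * d k s) atTop (𝓝 0))
    ?_ ?_ ?_ ?_ hg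
  · intro c S hS hμ
    have hgi : Integrable (S.indicator fun _ => c) volume :=
      (integrable_indicator_iff hS).2 (integrableOn_const hμ.ne)
    refine tendsto_integral_mul_closed hdm hd hgi fun ε hε => ?_
    have hlim : Tendsto (fun m : ℕ => ∫ s, ‖S.indicator (fun _ => c) s -
        (Ioc (-(m:ℝ)) m).indicator (S.indicator fun _ => c) s‖) atTop (𝓝 0) := by
      have h0 : (0:ℝ) = ∫ s : ℝ, (0:ℝ) := by simp
      rw [h0]
      refine tendsto_integral_of_dominated_convergence
        (fun s => ‖S.indicator (fun _ => c) s‖) (fun m => ?_) hgi.norm (fun m => ?_) ?_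
      · exact (hgi.sub (hgi.indicator measurableSet_Ioc)).norm.aestronglyMeasurable
      · refine Eventually.of_forall fun s => ?_
        by_cases hs : s ∈ Ioc (-(m:ℝ)) m <;> simp [hs]
      · refine Eventually.of_forall fun s => ?_
        refine tendsto_const_nhds.congr' ?_
        obtain ⟨M, hM⟩ := exists_nat_gt |s|
        filter_upwards [eventually_ge_atTop M] with m hm
        have hm' : (M:ℝ) ≤ m := by exact_mod_cast hm
        have : s ∈ Ioc (-(m:ℝ)) m := by
          have := abs_lt.1 (hM.trans_le hm')
          exact ⟨this.1, this.2.le⟩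
        simp [this]
    obtain ⟨m, hm⟩ := (hlim.eventually (gt_mem_nhds hε)).exists
    refine ⟨_, hgi.indicator measurableSet_Ioc, hm.le, ?_⟩
    have h1 := (tendsto_setIntegral_of_intervals hdm hd H m (Nat.cast_nonneg m) S hS).const_mul c
    rw [mul_zero] at h1
    refine h1.congr fun k => ?_
    rw [← integral_const_mul, ← integral_indicator (hS.inter measurableSet_Ioc)]
    congr 1; ext s
    by_cases h1 : s ∈ S <;> by_cases h2 : s ∈ Ioc (-(m:ℝ)) m <;> simp [h1, h2]
  · intro f g _ hf hg ihf ihg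
    have : ∀ k, ∫ s, (f + g) s * d k s = (∫ s, f s * d k s) + ∫ s, g s * d k s := by
      intro k
      rw [← integral_add (i1 k hf) (i1 k hg)]
      congr 1; ext s; simp only [Pi.add_apply]; ring
    simp_rw [this]
    simpa using ihf.add ihg
  · refine isClosed_of_closure_subset fun f hf => ?_
    refine tendsto_integral_mul_closed hdm hd (L1.integrable_coeFn f) fun ε hε => ?_
    obtain ⟨g, hg, hfg⟩ := Metric.mem_closure_iff.1 hf ε hε
    refine ⟨g, L1.integrable_coeFn g, ?_, hg⟩
    rw [dist_eq_norm, L1.norm_eq_integral_norm] at hfg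
    refine le_trans (le_of_eq ?_) hfg.le
    refine integral_congr_ae ?_
    filter_upwards [Lp.coeFn_sub f g] with s hs
    rw [hs]; rfl
  · intro f g hfg hf ihf
    refine ihf.congr fun k => integral_congr_ae ?_
    filter_upwards [hfg] with s hs
    rw [hs]

theorem simplexU_le_one {N : ℕ} {w : Fin N → ℝ} (hw : w ∈ simplexU N) (i : Fin N) : w i ≤ 1 := by
  rw [← hw.2]
  exact Finset.single_le_sum (f := w) (fun j _ => hw.1 j) (Finset.mem_univ i)

theorem simplexU_abs_le {N : ℕ} {w : Fin N → ℝ} (hw : w ∈ simplexU N) (i : Fin N) :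
    |w i| ≤ 1 := by
  rw [abs_of_nonneg (hw.1 i)]; exact simplexU_le_one hw i

theorem intervalIntegrable_of_bdd {F : Type*} [NormedAddCommGroup F] {w : ℝ → F} {C : ℝ}
    (hm : AEStronglyMeasurable w volume) (hb : ∀ᵐ s, ‖w s‖ ≤ C) (a b : ℝ) :
    IntervalIntegrable w volume a b := by
  rw [intervalIntegrable_iff]
  exact Measure.integrableOn_of_bounded (M := C) (by simp [uIoc]) hm (ae_restrict_of_ae hb)

theorem weak_compact {N : ℕ} (v : ℕ → ℝ → Fin N → ℝ) (hm : ∀ k, Measurable (v k))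
    (hs : ∀ k t, v k t ∈ simplexU N) :
    ∃ φ : ℕ → ℕ, StrictMono φ ∧ ∃ u : ℝ → Fin N → ℝ, IsControl u ∧
      WeakConv (fun k => v (φ k)) u := by
  have hmi : ∀ k i, Measurable (fun t => v k t i) := fun k i => (measurable_pi_apply i).comp (hm k)
  have hintegr : ∀ k i a b, IntervalIntegrable (fun t => v k t i) volume a b := fun k i a b =>
    intervalIntegrable_of_bdd (C := 1) (hmi k i).aestronglyMeasurable
      (Eventually.of_forall fun t => simplexU_abs_le (hs k t) i) a b
  set V : ℕ → ℝ → Fin N → ℝ := fun k s i => ∫ τ in (0:ℝ)..s, v k τ i with hV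
  have hVsub : ∀ k i a b, V k b i - V k a i = ∫ τ in a..b, v k τ i := fun k i a b =>
    intervalIntegral.integral_interval_sub_left (hintegr k i 0 b) (hintegr k i 0 a)
  have hVL : ∀ k, LipschitzWith 1 (V k) := by
    intro k
    refine LipschitzWith.of_dist_le_mul fun s r => ?_
    rw [dist_pi_le_iff (by positivity)]
    intro i
    rw [Real.dist_eq, hVsub, Real.dist_eq]
    exact intervalIntegral.norm_integral_le_of_norm_le_const (f := fun t => v k t i) (C := 1)
      (fun t _ => simplexU_abs_le (hs k t) i)
  obtain ⟨φ, hφ, Z, hZL, hZ⟩ := exists_subseq_lip 1 V hVL 0 (by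
    intro k
    have : V k 0 = 0 := by ext i; simp [hV]
    simp [this])
  have hZi : ∀ i s, Tendsto (fun k => V (φ k) s i) atTop (𝓝 (Z s i)) := fun i s =>
    (tendsto_pi_nhds.1 (hZ s)) i
  have hZLi : ∀ i, LipschitzWith 1 (fun s => Z s i) := by
    intro i
    have := (LipschitzWith.eval (α := fun _ : Fin N => ℝ) i).comp hZL
    rw [one_mul] at this
    exact this
  have hmono : ∀ i, Monotone (fun s => Z s i) := by
    intro i s r hsr
    refine le_of_tendsto_of_tendsto' (hZi i s) (hZi i r) fun k => ?_
    rw [← sub_nonneg, hVsub]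
    exact intervalIntegral.integral_nonneg hsr fun t _ => (hs _ t).1 i
  have hsum : ∀ s, ∑ i, Z s i = s := by
    intro s
    have h1 := tendsto_finsetSum Finset.univ (fun i _ => hZi i s)
    refine tendsto_nhds_unique h1 (tendsto_const_nhds.congr fun k => ?_)
    simp only [hV]
    rw [← intervalIntegral.integral_finsetSum (fun i _ => hintegr _ i _ _)]
    simp [(hs _ _).2]
  set D : Set ℝ := {t | ∀ i, DifferentiableAt ℝ (fun s => Z s i) t} with hD
  have hDm : MeasurableSet D := by
    rw [hD, ofPred_forall]
    exact MeasurableSet.iInter fun i => measurableSet_of_differentiableAt ℝ _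
  have hDae : ∀ᵐ t, t ∈ D := by
    rw [hD]
    simp only [mem_ofPred_eq]
    rw [ae_all_iff]
    exact fun i => (hZLi i).ae_differentiableAt_real
  classical
  set u : ℝ → Fin N → ℝ := fun t i => if t ∈ D then deriv (fun s => Z s i) t else v 0 0 i with hu
  have hum : ∀ i, Measurable (fun t => u t i) := fun i =>
    Measurable.ite hDm (measurable_deriv _) measurable_const
  have hus : ∀ t, u t ∈ simplexU N := by
    intro t
    by_cases ht : t ∈ D
    · refine ⟨fun i => ?_, ?_⟩
      · simp only [hu, ht, if_true]
        exact (hmono i).deriv_nonneg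
      · simp only [hu, ht, if_true]
        rw [← deriv_fun_sum (fun i _ => ht i)]
        have : (fun s => ∑ i, Z s i) = id := funext hsum
        rw [this]; simp
    · have : u t = v 0 0 := by ext i; simp [hu, ht]
      rw [this]; exact hs 0 0
  have huint : ∀ i a b, ∫ t in a..b, u t i = Z b i - Z a i := by
    intro i a b
    rw [← ((hZLi i).lipschitzOnWith (s := uIcc a b)).absolutelyContinuousOnInterval.integral_deriv_eq_sub]
    refine intervalIntegral.integral_congr_ae ?_
    filter_upwards [hDae] with t ht _
    simp [hu, ht]
  have huii : ∀ i a b, IntervalIntegrable (fun t => u t i) volume a b := fun i a b =>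
    intervalIntegrable_of_bdd (C := 1) (hum i).aestronglyMeasurable
      (Eventually.of_forall fun t => simplexU_abs_le (hus t) i) a b
  refine ⟨φ, hφ, u, ⟨measurable_pi_iff.2 hum, hus⟩, ?_⟩
  intro g hg
  have hgi : ∀ i, Integrable (fun t => g t i) volume := fun i => hg.eval i
  have hgv : ∀ k i, Integrable (fun t => g t i * v k t i) volume := fun k i =>
    (hgi i).mul_bdd (c := 1) (hmi k i).aestronglyMeasurable
      (Eventually.of_forall fun t => simplexU_abs_le (hs k t) i)
  have hgu : ∀ i, Integrable (fun t => g t i * u t i) volume := fun i =>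
    (hgi i).mul_bdd (c := 1) (hum i).aestronglyMeasurable
      (Eventually.of_forall fun t => simplexU_abs_le (hus t) i)
  rw [integral_finsetSum _ (fun i _ => hgu i)]
  have h1 : ∀ k, ∫ t, ∑ i, g t i * v (φ k) t i = ∑ i, ∫ t, g t i * v (φ k) t i := fun k =>
    integral_finsetSum _ (fun i _ => hgv _ i)
  simp_rw [h1]
  refine tendsto_finsetSum _ fun i _ => ?_
  have key := tendsto_integral_mul_of_intervals (d := fun k t => v (φ k) t i - u t i)
    (fun k => (hmi _ i).sub (hum i)) (fun k t => by
      have h1 := simplexU_abs_le (hs (φ k) t) i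
      have h2 := simplexU_abs_le (hus t) i
      have h3 := abs_sub (v (φ k) t i) (u t i)
      linarith) (fun a b => by
      have h2 : ∀ k, ∫ t in a..b, (v (φ k) t i - u t i) =
          (V (φ k) b i - V (φ k) a i) - (Z b i - Z a i) := by
        intro k
        rw [intervalIntegral.integral_sub (hintegr _ _ _ _) (huii _ _ _), hVsub, huint]
      simp_rw [h2]
      have := ((hZi i b).sub (hZi i a)).sub_const (Z b i - Z a i)
      simpa using this) (hgi i)
  have key2 := key.add_const (∫ t, g t i * u t i)
  rw [zero_add] at key2
  refine key2.congr fun k => ?_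
  rw [← integral_add _ (hgu i)]
  · congr 1; ext t; ring
  · refine ((hgv (φ k) i).sub (hgu i)).congr (Eventually.of_forall fun t => ?_)
    simp only [Pi.sub_apply]; ring

theorem IsSwitchingSignal.measurable {N : ℕ} {σ : ℝ → Fin N} (h : IsSwitchingSignal σ) :
    Measurable σ := by
  have key : ∀ (m : ℕ) (i : Fin N), MeasurableSet (σ ⁻¹' {i} ∩ Ico (-((m:ℝ)+1)) (m+1)) := by
    intro m i
    obtain ⟨k, τ, h0, hk, hlt, hc⟩ := h (-((m:ℝ)+1)) (m+1) (by
      have : (0:ℝ) ≤ m := Nat.cast_nonneg m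
      linarith)
    have hcov : ∀ j, j ≤ k → ∀ s, s ∈ Ico (τ 0) (τ j) → ∃ l < j, s ∈ Ico (τ l) (τ (l+1)) := by
      intro j
      induction j with
      | zero => intro _ s hs; simp at hs
      | succ j ih =>
        intro hj s hs
        by_cases hsj : s < τ j
        · obtain ⟨l, hl, hsl⟩ := ih (by omega) s ⟨hs.1, hsj⟩
          exact ⟨l, by omega, hsl⟩
        · exact ⟨j, by omega, not_lt.1 hsj, hs.2⟩
    have hle : ∀ j, j ≤ k → τ 0 ≤ τ j ∧ τ j ≤ τ k := by
      intro j hj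
      have hmon : ∀ b, b ≤ k → ∀ a, a ≤ b → τ a ≤ τ b := by
        intro b
        induction b with
        | zero => intro _ a ha; rw [Nat.le_zero.1 ha]
        | succ b ih =>
          intro hb a ha
          rcases Nat.lt_or_ge a (b+1) with h' | h'
          · exact (ih (by omega) a (by omega)).trans (hlt b (by omega)).le
          · rw [le_antisymm ha h']
      exact ⟨hmon j hj 0 (by omega), hmon k le_rfl j hj⟩
    have he : σ ⁻¹' {i} ∩ Ico (-((m:ℝ)+1)) (m+1) =
        ⋃ j ∈ {j | j < k ∧ σ (τ j) = i}, Ico (τ j) (τ (j+1)) := by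
      ext s
      simp only [mem_inter_iff, mem_preimage, mem_singleton_iff, mem_ofPred_eq, mem_iUnion,
        exists_prop]
      constructor
      · rintro ⟨h1, h2⟩
        rw [← h0, ← hk] at h2
        obtain ⟨l, hl, hsl⟩ := hcov k le_rfl s h2
        exact ⟨l, ⟨hl, by rw [← hc l hl s hsl, h1]⟩, hsl⟩
      · rintro ⟨j, ⟨hj, h1⟩, h2⟩
        refine ⟨by rw [hc j hj s h2, h1], ?_⟩
        rw [← h0, ← hk]
        exact ⟨(hle j hj.le).1.trans h2.1, h2.2.trans_le (hle (j+1) hj).2⟩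
    rw [he]
    exact MeasurableSet.biUnion (Set.to_countable _) fun j _ => measurableSet_Ico
  refine measurable_to_countable' fun i => ?_
  have : σ ⁻¹' {i} = ⋃ m : ℕ, (σ ⁻¹' {i} ∩ Ico (-((m:ℝ)+1)) (m+1)) := by
    rw [← inter_iUnion]
    refine (inter_eq_left.2 fun s _ => ?_).symm
    obtain ⟨m, hm⟩ := exists_nat_gt |s|
    have := abs_lt.1 hm
    exact mem_iUnion.2 ⟨m, by linarith, by linarith⟩
  rw [this]
  exact MeasurableSet.iUnion fun m => key m i

theorem stdVec_mem {N : ℕ} (i : Fin N) : stdVec N i ∈ simplexU N := by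
  refine ⟨fun j => ?_, ?_⟩
  · simp only [stdVec]; split_ifs <;> norm_num
  · simp [stdVec]

theorem ctrl_measurable {N : ℕ} {σ : ℝ → Fin N} (h : IsSwitchingSignal σ) (c : ℝ) :
    Measurable (fun s => ctrlOfSwitch σ (c + s)) := by
  have : Measurable (stdVec N) := measurable_from_top
  exact (this.comp h.measurable).comp (measurable_const_add c)

/-- Composition of a Carathéodory function with a continuous curve is a.e. measurable. -/
theorem aesm_comp {X F : Type*} [NormedAddCommGroup X] [MeasurableSpace X] [BorelSpace X]
    [NormedAddCommGroup F] [MeasurableSpace F] [BorelSpace F] [SecondCountableTopology F]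
    {K : Set X} (hK : IsCompact K) (g : ℝ → X → F)
    (hm : ∀ ξ ∈ K, Measurable fun t => g t ξ) (A : Set ℝ) (hA : MeasurableSet A)
    (hc : ∀ᵐ t, t ∈ A → ContinuousOn (g t) K) (y : ℝ → X) (hy : Continuous y)
    (hyK : ∀ s, y s ∈ K) :
    AEStronglyMeasurable (fun s => g s (y s)) (volume.restrict A) := by
  have : CompactSpace K := isCompact_iff_compactSpace.1 hK
  obtain ⟨B, hBs, hBm, hB0⟩ := exists_measurable_superset_of_null (ae_iff.1 hc)
  classical
  let G : K → ℝ → F := fun ξ t => if t ∈ A \ B then g t ξ else 0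
  have hG1 : ∀ t, Continuous fun ξ => G ξ t := by
    intro t
    by_cases ht : t ∈ A \ B
    · have h1 : ContinuousOn (g t) K := by
        by_contra hcon
        exact ht.2 (hBs (by
          simp only [mem_ofPred_eq]; exact fun h => hcon (h ht.1)))
      simp only [G, ht, if_true]
      exact continuousOn_iff_continuous_domRestrict.1 h1
    · simp only [G, ht, if_false]; exact continuous_const
  have hG2 : ∀ ξ, Measurable (G ξ) := fun ξ =>
    Measurable.ite (hA.diff hBm) (hm ξ ξ.2) measurable_const
  have hG := measurable_uncurry_of_continuous_of_measurable (u := G) hG1 hG2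
  have hy' : Measurable fun s => ((⟨y s, hyK s⟩ : K), s) :=
    (hy.measurable.subtype_mk).prodMk measurable_id
  have hfin : Measurable fun s => G ⟨y s, hyK s⟩ s := hG.comp hy'
  refine hfin.aestronglyMeasurable.congr ?_
  have hB' : ∀ᵐ t ∂(volume.restrict A), t ∉ B :=
    ae_restrict_of_ae (measure_eq_zero_iff_ae_notMem.1 hB0)
  filter_upwards [hB', ae_restrict_mem hA] with t h1 h2
  simp only [G]
  rw [if_pos ⟨h2, h1⟩]

section conv

variable {N : ℕ} {v : ℕ → ℝ → Fin N → ℝ} {u : ℝ → Fin N → ℝ}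

theorem conv_lemma (hvm : ∀ k, Measurable (v k)) (hvs : ∀ k t, v k t ∈ simplexU N)
    (hw : WeakConv v u)
    (G : ℕ → ℝ → Fin N → ℝ) (Gl : ℝ → Fin N → ℝ) (C : ℝ)
    (hGm : ∀ k i, AEStronglyMeasurable (fun s => G k s i) volume)
    (hGb : ∀ k i, ∀ᵐ s, |G k s i| ≤ C)
    (hGl : ∀ i, ∀ᵐ s, Tendsto (fun k => G k s i) atTop (𝓝 (Gl s i)))
    (A : Set ℝ) (hA : MeasurableSet A) (hAf : volume A < ⊤) :
    Tendsto (fun k => ∫ s in A, ∑ i, v k s i * G k s i) atTop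
      (𝓝 (∫ s in A, ∑ i, u s i * Gl s i)) := by
  have hvi : ∀ k i, Measurable (fun t => v k t i) := fun k i => (measurable_pi_apply i).comp (hvm k)
  have hGlm : ∀ i, AEStronglyMeasurable (fun s => Gl s i) volume := fun i =>
    aestronglyMeasurable_of_tendsto_ae atTop (fun k => hGm k i) (hGl i)
  have hGlb : ∀ i, ∀ᵐ s, |Gl s i| ≤ C := by
    intro i
    filter_upwards [hGl i, ae_all_iff.2 fun k => hGb k i] with s h1 h2
    exact le_of_tendsto h1.abs (Eventually.of_forall h2)
  have hbi : ∀ {g : ℝ → ℝ} (D : ℝ), AEStronglyMeasurable g volume → (∀ᵐ s, |g s| ≤ D) →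
      IntegrableOn g A volume := fun D h1 h2 =>
    Measure.integrableOn_of_bounded (M := D) hAf.ne h1 (ae_restrict_of_ae h2)
  have hGlA : ∀ i, Integrable (A.indicator fun s => Gl s i) volume := fun i =>
    (integrable_indicator_iff hA).2 (hbi C (hGlm i) (hGlb i))
  have h1 := hw (fun s i => A.indicator (fun s => Gl s i) s) (Integrable.of_eval hGlA)
  have e1 : ∀ w : ℝ → Fin N → ℝ, ∫ s, ∑ i, A.indicator (fun s => Gl s i) s * w s i =
      ∫ s in A, ∑ i, w s i * Gl s i := by
    intro w
    rw [← integral_indicator hA]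
    congr 1; ext s
    by_cases hs : s ∈ A <;> simp [hs, mul_comm]
  simp only [e1] at h1
  have h2 : Tendsto (fun k => ∫ s in A, ∑ i, v k s i * (G k s i - Gl s i)) atTop (𝓝 0) := by
    have h0 : (0:ℝ) = ∫ s in A, (0:ℝ) := by simp
    rw [h0]
    refine tendsto_integral_of_dominated_convergence (fun _ => ∑ i : Fin N, (C + C))
      (fun k => ?_) (integrableOn_const hAf.ne) (fun k => ?_) ?_
    · refine AEStronglyMeasurable.restrict ?_
      refine Finset.aestronglyMeasurable_fun_sum _ fun i _ => ?_
      exact (hvi k i).aestronglyMeasurable.mul ((hGm k i).sub (hGlm i))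
    · refine ae_restrict_of_ae ?_
      filter_upwards [ae_all_iff.2 fun i => hGb k i, ae_all_iff.2 hGlb] with s h1 h2
      refine (norm_sum_le _ _).trans (Finset.sum_le_sum fun i _ => ?_)
      rw [norm_mul, Real.norm_eq_abs, Real.norm_eq_abs]
      have h3 := simplexU_abs_le (hvs k s) i
      have h4 := abs_sub (G k s i) (Gl s i)
      have h5 := h1 i
      have h6 := h2 i
      nlinarith [abs_nonneg (v k s i), abs_nonneg (G k s i - Gl s i)]
    · refine ae_restrict_of_ae ?_
      filter_upwards [ae_all_iff.2 hGl] with s h1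
      rw [show (0:ℝ) = ∑ i : Fin N, (0:ℝ) by simp]
      refine tendsto_finsetSum _ fun i _ => ?_
      have h3 : Tendsto (fun k => G k s i - Gl s i) atTop (𝓝 0) := by
        simpa using (h1 i).sub_const (Gl s i)
      exact bdd_le_mul_tendsto_zero' 1
        (Eventually.of_forall fun k => simplexU_abs_le (hvs k s) i) h3
  have h3 := h1.add h2
  rw [add_zero] at h3
  refine h3.congr fun k => ?_
  have i1 : ∀ i, IntegrableOn (fun s => v k s i * Gl s i) A volume := fun i =>
    (hbi C (hGlm i) (hGlb i)).bdd_mul (c := 1) (hvi k i).aestronglyMeasurable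
      (Eventually.of_forall fun t => simplexU_abs_le (hvs k t) i)
  have i2 : ∀ i, IntegrableOn (fun s => v k s i * (G k s i - Gl s i)) A volume := fun i =>
    ((hbi C (hGm k i) (hGb k i)).sub (hbi C (hGlm i) (hGlb i))).bdd_mul (c := 1)
      (hvi k i).aestronglyMeasurable (Eventually.of_forall fun t => simplexU_abs_le (hvs k t) i)
  rw [← integral_add (integrable_finsetSum _ fun i _ => i1 i)
    (integrable_finsetSum _ fun i _ => i2 i)]
  congr 1; ext s
  rw [← Finset.sum_add_distrib]
  refine Finset.sum_congr rfl fun i _ => ?_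
  ring

theorem conv_ae_zero (hvm : ∀ k, Measurable (v k)) (hvs : ∀ k t, v k t ∈ simplexU N)
    (huc : IsControl u) (hw : WeakConv v u)
    (G : ℕ → ℝ → Fin N → ℝ) (Gl : ℝ → Fin N → ℝ) (C : ℝ)
    (hGm : ∀ k i, AEStronglyMeasurable (fun s => G k s i) volume)
    (hGb : ∀ k i, ∀ᵐ s, |G k s i| ≤ C)
    (hGl : ∀ i, ∀ᵐ s, Tendsto (fun k => G k s i) atTop (𝓝 (Gl s i)))
    (hpos : ∀ s i, 0 ≤ Gl s i)
    (hz : ∀ᵐ s, Tendsto (fun k => ∑ i, v k s i * G k s i) atTop (𝓝 0)) :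
    ∀ᵐ s, ∑ i, u s i * Gl s i = 0 := by
  have hvi : ∀ k i, Measurable (fun t => v k t i) := fun k i => (measurable_pi_apply i).comp (hvm k)
  have hui : ∀ i, Measurable (fun t => u t i) := fun i => (measurable_pi_apply i).comp huc.1
  have hGlm : ∀ i, AEStronglyMeasurable (fun s => Gl s i) volume := fun i =>
    aestronglyMeasurable_of_tendsto_ae atTop (fun k => hGm k i) (hGl i)
  have hGlb : ∀ i, ∀ᵐ s, |Gl s i| ≤ C := by
    intro i
    filter_upwards [hGl i, ae_all_iff.2 fun k => hGb k i] with s h1 h2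
    exact le_of_tendsto h1.abs (Eventually.of_forall h2)
  have bnd : ∀ (w g : Fin N → ℝ), w ∈ simplexU N → (∀ i, |g i| ≤ C) →
      ‖∑ i, w i * g i‖ ≤ ∑ i : Fin N, C := by
    intro w g h1 h2
    refine (norm_sum_le _ _).trans (Finset.sum_le_sum fun i _ => ?_)
    rw [norm_mul, Real.norm_eq_abs, Real.norm_eq_abs]
    have h3 := simplexU_abs_le h1 i
    have h5 := h2 i
    nlinarith [abs_nonneg (w i), abs_nonneg (g i)]
  have key : ∀ m : ℕ, ∀ᵐ s, s ∈ Icc (-(m:ℝ)) m → ∑ i, u s i * Gl s i = 0 := by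
    intro m
    have hfin : volume (Icc (-(m:ℝ)) m) < ⊤ := by simp
    have h1 := conv_lemma hvm hvs hw G Gl C hGm hGb hGl (Icc (-(m:ℝ)) m) measurableSet_Icc hfin
    have h2 : Tendsto (fun k => ∫ s in Icc (-(m:ℝ)) m, ∑ i, v k s i * G k s i) atTop (𝓝 0) := by
      have h0 : (0:ℝ) = ∫ s in Icc (-(m:ℝ)) m, (0:ℝ) := by simp
      rw [h0]
      refine tendsto_integral_of_dominated_convergence (fun _ => ∑ i : Fin N, C)
        (fun k => ?_) (integrableOn_const hfin.ne) (fun k => ?_) (ae_restrict_of_ae hz)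
      · refine AEStronglyMeasurable.restrict ?_
        refine Finset.aestronglyMeasurable_fun_sum _ fun i _ => ?_
        exact (hvi k i).aestronglyMeasurable.mul (hGm k i)
      · refine ae_restrict_of_ae ?_
        filter_upwards [ae_all_iff.2 fun i => hGb k i] with s h1
        exact bnd _ _ (hvs k s) h1
    have h3 := tendsto_nhds_unique h1 h2
    rw [setIntegral_eq_zero_iff_of_nonneg_ae] at h3
    · have := (ae_restrict_iff' measurableSet_Icc).1 h3
      exact this
    · exact Eventually.of_forall fun s =>
        Finset.sum_nonneg fun i _ => mul_nonneg ((huc.2 s).1 i) (hpos s i)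
    · refine Measure.integrableOn_of_bounded (M := ∑ i : Fin N, C) hfin.ne ?_ ?_
      · refine Finset.aestronglyMeasurable_fun_sum _ fun i _ => ?_
        exact (hui i).aestronglyMeasurable.mul (hGlm i)
      · refine ae_restrict_of_ae ?_
        filter_upwards [ae_all_iff.2 hGlb] with s h1
        exact bnd _ _ (huc.2 s) h1
  filter_upwards [ae_all_iff.2 key] with s hs
  obtain ⟨m, hm⟩ := exists_nat_gt |s|
  have := abs_lt.1 hm
  exact hs m ⟨this.1.le, this.2.le⟩

end conv

theorem ClassK.tendsto_zero {ω : ℝ → ℝ} (hω : ClassK ω) {a : ℕ → ℝ} (ha : ∀ k, 0 ≤ a k)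
    (h : Tendsto a atTop (𝓝 0)) : Tendsto (fun k => ω (a k)) atTop (𝓝 0) := by
  have h1 : ContinuousWithinAt ω (Ici 0) 0 := hω.1 0 (by simp)
  have h2 : Tendsto a atTop (𝓝[Ici 0] 0) :=
    tendsto_nhdsWithin_iff.2 ⟨h, Eventually.of_forall ha⟩
  have := h1.tendsto.comp h2
  rw [hω.2.2] at this
  exact this

theorem ae_of_null_diff {J' : Set ℝ} (h : volume (Ici (0:ℝ) \ J') = 0) :
    ∀ᵐ t, 0 ≤ t → t ∈ J' := by
  filter_upwards [measure_eq_zero_iff_ae_notMem.1 h] with t ht h0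
  by_contra hc
  exact ht ⟨h0, hc⟩

theorem ae_shift {P : ℝ → Prop} (h : ∀ᵐ t, P t) (c : ℝ) : ∀ᵐ s, P (c + s) :=
  (measurePreserving_add_left volume c).quasiMeasurePreserving.ae h

theorem UnifBounded.ae {X F : Type*} [TopologicalSpace X] [NormedAddCommGroup F]
    {𝒳 : Set X} {g : ℝ → X → F} (h : UnifBounded 𝒳 g) {K : Set X} (hK : IsCompact K)
    (hK' : K ⊆ 𝒳) : ∃ C : ℝ, ∀ᵐ t, 0 ≤ t → ∀ ξ ∈ K, ‖g t ξ‖ ≤ C := by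
  obtain ⟨J', -, h0, h1⟩ := h
  obtain ⟨C, hC⟩ := h1 K hK hK'
  refine ⟨C, ?_⟩
  filter_upwards [ae_of_null_diff h0] with t ht h0
  exact hC t (ht h0)

theorem unifBounded_fam {X F : Type*} [TopologicalSpace X] [NormedAddCommGroup F] {N : ℕ}
    {𝒳 : Set X} {g : ℝ → X → Fin N → F} (h : ∀ i, UnifBounded 𝒳 fun t ξ => g t ξ i)
    {K : Set X} (hK : IsCompact K) (hK' : K ⊆ 𝒳) :
    ∃ C : ℝ, 0 ≤ C ∧ ∀ᵐ t, 0 ≤ t → ∀ ξ ∈ K, ∀ i, ‖g t ξ i‖ ≤ C := by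
  choose C hC using fun i => (h i).ae hK hK'
  refine ⟨∑ i, |C i|, by positivity, ?_⟩
  filter_upwards [ae_all_iff.2 hC] with t ht h0 ξ hξ i
  refine (ht i h0 ξ hξ).trans ((le_abs_self _).trans ?_)
  exact Finset.single_le_sum (f := fun i => |C i|) (fun j _ => abs_nonneg _) (Finset.mem_univ i)

theorem ContXiUnifT.ae {X F : Type*} [NormedAddCommGroup X] [NormedAddCommGroup F]
    {𝒳 : Set X} {g : ℝ → X → F} (h : ContXiUnifT 𝒳 g) {K : Set X} (hK : IsCompact K)
    (hK' : K ⊆ 𝒳) : ∃ ω : ℝ → ℝ, ClassK ω ∧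
      ∀ᵐ t, 0 ≤ t → ∀ ξ ∈ K, ∀ ζ ∈ K, ‖g t ξ - g t ζ‖ ≤ ω ‖ξ - ζ‖ := by
  obtain ⟨J', -, h0, h1⟩ := h
  obtain ⟨ω, hω, hC⟩ := h1 K hK hK'
  refine ⟨ω, hω, ?_⟩
  filter_upwards [ae_of_null_diff h0] with t ht h0
  exact hC t (ht h0)

theorem ContXiUnifT.ae_cont {X F : Type*} [NormedAddCommGroup X] [NormedAddCommGroup F]
    {𝒳 : Set X} {g : ℝ → X → F} (h : ContXiUnifT 𝒳 g) {K : Set X} (hK : IsCompact K)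
    (hK' : K ⊆ 𝒳) : ∀ᵐ t, 0 ≤ t → ContinuousOn (g t) K := by
  obtain ⟨ω, hω, h1⟩ := h.ae hK hK'
  filter_upwards [h1] with t ht h0
  intro ξ hξ
  refine tendsto_of_seq_tendsto fun z hz => ?_
  rw [tendsto_nhdsWithin_iff] at hz
  rw [tendsto_iff_norm_sub_tendsto_zero]
  have h2 := hω.tendsto_zero (fun k => norm_nonneg _) (tendsto_iff_norm_sub_tendsto_zero.1 hz.1)
  refine squeeze_zero' (Eventually.of_forall fun k => norm_nonneg _) ?_ h2
  filter_upwards [hz.2] with k hk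
  exact ht h0 _ hk _ hξ

/-- Windowed shift of a time-varying map composed with a curve. -/
def win {X F : Type*} [Zero F] (g : ℝ → X → F) (c m : ℝ) (y : ℝ → X) : ℝ → F :=
  (Icc (-m) m).indicator fun s => g (c + s) (y s)

theorem win_aesm {X F : Type*} [NormedAddCommGroup X] [MeasurableSpace X] [BorelSpace X]
    [NormedAddCommGroup F] [MeasurableSpace F] [BorelSpace F] [SecondCountableTopology F]
    {K : Set X} (hK : IsCompact K) (g : ℝ → X → F)
    (hm : ∀ ξ ∈ K, Measurable fun t => g t ξ)
    (hc : ∀ᵐ t, 0 ≤ t → ContinuousOn (g t) K) (c m : ℝ) (hcm : m ≤ c) (y : ℝ → X)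
    (hy : Continuous y) (hyK : ∀ s, y s ∈ K) :
    AEStronglyMeasurable (win g c m y) volume := by
  refine (aestronglyMeasurable_indicator_iff measurableSet_Icc).2 ?_
  refine aesm_comp hK (fun s ξ => g (c + s) ξ)
    (fun ξ hξ => (hm ξ hξ).comp (measurable_const_add c)) _ measurableSet_Icc ?_ y hy hyK
  filter_upwards [ae_shift hc c] with s hs hsm
  exact hs (by linarith [hsm.1])

theorem win_bound {X F : Type*} [NormedAddCommGroup F]
    {K : Set X} (g : ℝ → X → F) {C : ℝ} (hC0 : 0 ≤ C)
    (hC : ∀ᵐ t, 0 ≤ t → ∀ ξ ∈ K, ‖g t ξ‖ ≤ C) (c m : ℝ) (hcm : m ≤ c) (y : ℝ → X)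
    (hyK : ∀ s, y s ∈ K) : ∀ᵐ s, ‖win g c m y s‖ ≤ C := by
  filter_upwards [ae_shift hC c] with s hs
  by_cases h : s ∈ Icc (-m) m
  · simp only [win, h, indicator_of_mem]
    exact hs (by linarith [h.1]) _ (hyK s)
  · simpa [win, h] using hC0

theorem eventually_mem_win (s : ℝ) : ∀ᶠ k : ℕ in atTop, s ∈ Icc (-(k:ℝ)) k := by
  obtain ⟨M, hM⟩ := exists_nat_gt |s|
  filter_upwards [eventually_ge_atTop M] with m hm
  have hm' : (M:ℝ) ≤ m := by exact_mod_cast hm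
  have := abs_lt.1 (hM.trans_le hm')
  exact ⟨this.1.le, this.2.le⟩

theorem win_tendsto {X F : Type*} [NormedAddCommGroup X] [NormedAddCommGroup F]
    {𝒳 K : Set X} (hK : IsCompact K) (hK' : K ⊆ 𝒳) (g : ℝ → X → F) (h : ContXiUnifT 𝒳 g)
    (t : ℕ → ℝ) (ht : ∀ k : ℕ, (k:ℝ) ≤ t k) (gl : ℝ → X → F) (hl : IsLimitAlong 𝒳 g t gl)
    (y : ℕ → ℝ → X) (hyK : ∀ k s, y k s ∈ K) (z : ℝ → X) (hzK : ∀ s, z s ∈ K)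
    (hz : ∀ s, Tendsto (fun k => y k s) atTop (𝓝 (z s))) :
    ∀ᵐ s, Tendsto (fun k : ℕ => win g (t k) k (y k) s) atTop (𝓝 (gl s (z s))) := by
  obtain ⟨ω, hω, h1⟩ := h.ae hK hK'
  obtain ⟨B, hB, hlim⟩ := hl
  filter_upwards [measure_eq_zero_iff_ae_notMem.1 hB, ae_all_iff.2 fun k => ae_shift h1 (t k)]
    with s hs1 hs2
  have h3 := hlim (z s) (hK' (hzK s)) s hs1
  have h4 : Tendsto (fun k => g (t k + s) (y k s) - g (t k + s) (z s)) atTop (𝓝 0) := by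
    rw [tendsto_zero_iff_norm_tendsto_zero]
    refine squeeze_zero' (Eventually.of_forall fun k => norm_nonneg _) ?_
      (hω.tendsto_zero (fun k => norm_nonneg _) (tendsto_iff_norm_sub_tendsto_zero.1 (hz s)))
    filter_upwards [eventually_mem_win s] with k hk
    exact hs2 k (by linarith [ht k, hk.1]) _ (hyK k s) _ (hzK s)
  have h5 := h4.add h3
  rw [zero_add] at h5
  refine h5.congr' ?_
  filter_upwards [eventually_mem_win s] with k hk
  simp [win, hk]

theorem ZeroingOutputSeq.subseq {F : Type*} [NormedAddCommGroup F]
    {𝒯 : Set (Sol 𝒳 f)} {h : ℝ → E n → Fin N → F} {t : ℕ → ℝ} {T : ℕ → Sol 𝒳 f}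
    (H : ZeroingOutputSeq 𝒯 h t T) {φ : ℕ → ℕ} (hφ : StrictMono φ) :
    ZeroingOutputSeq 𝒯 h (t ∘ φ) (T ∘ φ) := by
  obtain ⟨h1, h2, h3, ⟨K, hK, hK', ε, hε, h4⟩, h5⟩ := H
  have hle : ∀ k : ℕ, (k:ℝ) ≤ φ k := fun k => by exact_mod_cast hφ.le_apply
  refine ⟨h1.comp hφ.tendsto_atTop, fun k => h2 _, fun k => ?_, ⟨K, hK, hK', ε, hε, ?_⟩, ?_⟩
  · obtain ⟨a, b⟩ := h3 (φ k)
    have := hle k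
    refine ⟨by simp only [Function.comp]; linarith, lt_of_le_of_lt ?_ b⟩
    rw [EReal.coe_le_coe_iff]
    simp only [Function.comp]; linarith
  · intro k s hs
    exact h4 (φ k) s (hs.trans (hle k))
  · filter_upwards [h5] with s hs
    exact hs.comp hφ.tendsto_atTop

theorem IsLimitAlong.subseq {X F : Type*} [TopologicalSpace F] {𝒳 : Set X} {g : ℝ → X → F}
    {γ : ℕ → ℝ} {gl : ℝ → X → F} (h : IsLimitAlong 𝒳 g γ gl) {φ : ℕ → ℕ} (hφ : StrictMono φ) :
    IsLimitAlong 𝒳 g (γ ∘ φ) gl := by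
  obtain ⟨B, hB, h1⟩ := h
  exact ⟨B, hB, fun ξ hξ s hs => (h1 ξ hξ s hs).comp hφ.tendsto_atTop⟩

theorem exists_subseq_limits {X F : Type*} [TopologicalSpace F] {𝒳 : Set X} {N : ℕ}
    (g : Fin N → ℝ → X → F) (hg : ∀ i, Precompact 𝒳 (g i)) (t : ℕ → ℝ)
    (ht : Tendsto t atTop atTop) :
    ∃ φ : ℕ → ℕ, StrictMono φ ∧ ∃ gl : Fin N → ℝ → X → F,
      ∀ i, IsLimitAlong 𝒳 (g i) (t ∘ φ) (gl i) := by
  have key : ∀ S : Finset (Fin N), ∃ φ : ℕ → ℕ, StrictMono φ ∧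
      ∀ i ∈ S, ∃ gl, IsLimitAlong 𝒳 (g i) (t ∘ φ) gl := by
    intro S
    induction S using Finset.induction_on with
    | empty => exact ⟨id, strictMono_id, by simp⟩
    | insert a S _ ih =>
      obtain ⟨φ, hφ, h1⟩ := ih
      obtain ⟨ψ, hψ, -, gl, hgl⟩ := hg a (t ∘ φ) (ht.comp hφ.tendsto_atTop)
      refine ⟨φ ∘ ψ, hφ.comp hψ, fun i hi => ?_⟩
      rcases Finset.mem_insert.1 hi with rfl | hi
      · exact ⟨gl, hgl⟩
      · obtain ⟨gl', h'⟩ := h1 i hi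
        exact ⟨gl', h'.subseq hψ⟩
  obtain ⟨φ, hφ, h1⟩ := key Finset.univ
  choose gl hgl using fun i => h1 i (Finset.mem_univ i)
  exact ⟨φ, hφ, gl, hgl⟩

/-- The zeroing pair property along a switched sequence. -/
theorem zeroing_switched {X F G : Type*} [NormedAddCommGroup X] [NormedAddCommGroup F]
    [NormedAddCommGroup G] {N : ℕ} {𝒳 : Set X} (h : ℝ → X → Fin N → F) (d : ℝ → X → Fin N → G)
    (hzp : ∀ i, ZeroingPair 𝒳 (fun t ξ => h t ξ i) fun t ξ => d t ξ i)
    {K : Set X} (hK : IsCompact K) (hK' : K ⊆ 𝒳) {ε : ℝ} (hε : 0 < ε)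
    (t : ℕ → ℝ) (ht : Tendsto t atTop atTop) (v : ℕ → X) (i : ℕ → Fin N)
    (hv : ∀ k, v k ∈ K) (hvε : ∀ k, ε ≤ ‖v k‖)
    (H : Tendsto (fun k => h (t k) (v k) (i k)) atTop (𝓝 0)) :
    Tendsto (fun k => d (t k) (v k) (i k)) atTop (𝓝 0) := by
  refine tendsto_of_subseq_tendsto fun ns hns => ?_
  -- some value of `i ∘ ns` is attained infinitely often
  obtain ⟨j, hj⟩ : ∃ j, ∃ᶠ k in atTop, i (ns k) = j := by
    by_contra hcon
    push Not at hcon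
    have h1 : ∀ᶠ k : ℕ in atTop, ∀ j, i (ns k) ≠ j :=
      eventually_all.2 fun j => hcon j
    obtain ⟨k, hk⟩ := h1.exists
    exact hk _ rfl
  obtain ⟨ψ, hψ, hψj⟩ := extraction_of_frequently_atTop hj
  refine ⟨ψ, ?_⟩
  have hlim : Tendsto (fun k => ns (ψ k)) atTop atTop := hns.comp hψ.tendsto_atTop
  have := hzp j (fun k => t (ns (ψ k))) (ht.comp hlim) K hK hK' ε hε (fun k => v (ns (ψ k)))
    (fun k => hv _) (fun k => hvε _) (by
      refine (H.comp hlim).congr fun k => ?_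
      simp only [Function.comp, hψj])
  refine this.congr fun k => ?_
  simp only [hψj]

theorem sum_stdVec_smul {V : Type*} [AddCommGroup V] [Module ℝ V] {N : ℕ} (i : Fin N)
    (w : Fin N → V) : ∑ j, stdVec N i j • w j = w i := by
  simp [stdVec]

/-- Clamp to `[-m, m]`. -/
def clamp (m s : ℝ) : ℝ := max (-m) (min s m)

theorem abs_clamp_le {m : ℝ} (hm : 0 ≤ m) (s : ℝ) : |clamp m s| ≤ m := by
  rw [abs_le, clamp]
  exact ⟨le_max_left _ _, max_le (by linarith) (min_le_right _ _)⟩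

theorem clamp_eq {m s : ℝ} (hs : s ∈ Icc (-m) m) : clamp m s = s := by
  rw [clamp, min_eq_left hs.2, max_eq_right hs.1]

theorem clamp_lip (m s r : ℝ) : |clamp m s - clamp m r| ≤ |s - r| := by
  unfold clamp
  refine (abs_max_sub_max_le_max _ _ _ _).trans ?_
  simp only [sub_self, abs_zero, abs_nonneg, sup_of_le_right]
  refine (abs_min_sub_min_le_max _ _ _ _).trans ?_
  simp

theorem sol_lip (T : Sol 𝒳 f) {K : Set (E n)} {C : ℝ}
    (hC : ∀ᵐ t, 0 ≤ t → ∀ ξ ∈ K, ∀ i, ‖f t ξ i‖ ≤ C) (c m : ℝ)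
    (h0 : T.t0 ≤ c - m) (hf : ((c + m : ℝ) : EReal) < T.tf)
    (hx : ∀ s, |s| ≤ m → T.x (c + s) ∈ K) :
    ∀ s r, |s| ≤ m → |r| ≤ m → ‖T.x (c + s) - T.x (c + r)‖ ≤ C * |s - r| := by
  have key : ∀ s r, |s| ≤ m → |r| ≤ m → r ≤ s → ‖T.x (c + s) - T.x (c + r)‖ ≤ C * |s - r| := by
    intro s r hs hr hrs
    rw [abs_le] at hs hr
    have h1 := T.sol (c + r) (c + s) (by linarith) (by linarith)
      (lt_of_le_of_lt (EReal.coe_le_coe_iff.2 (by linarith)) hf)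
    rw [h1, add_sub_cancel_left]
    have := intervalIntegral.norm_integral_le_of_norm_le_const_ae
      (f := fun τ => f τ (T.x τ) (T.σ τ)) (a := c + r) (b := c + s) (C := C) (by
        filter_upwards [hC] with τ hτ hmem
        rw [uIoc_of_le (by linarith)] at hmem
        have h2 := T.t0_nonneg
        refine hτ (by linarith [hmem.1]) _ ?_ _
        have := hx (τ - c) (abs_le.2 ⟨by linarith [hmem.1], by linarith [hmem.2]⟩)
        simpa using this)
    refine this.trans (le_of_eq ?_)
    congr 2; ring
  intro s r hs hr
  rcases le_total r s with h | h
  · exact key s r hs hr h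
  · rw [norm_sub_rev, abs_sub_comm]; exact key r s hr hs h

theorem mem_Uset_of {χ : Fin N → Set (E n)} {ξ : E n} {w : Fin N → ℝ} (hw : w ∈ simplexU N)
    (h : ∀ i, ξ ∉ χ i → w i = 0) : w ∈ Uset χ ξ := by
  classical
  have he : w = ∑ i, w i • stdVec N i := by
    ext j; simp [stdVec, Finset.sum_apply]
  have he2 : w = ∑ i ∈ Finset.univ.filter (fun i => ξ ∈ χ i), w i • stdVec N i := by
    conv_lhs => rw [he]
    rw [Finset.sum_filter]
    refine Finset.sum_congr rfl fun i _ => ?_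
    split_ifs with hi
    · rfl
    · rw [h i hi, zero_smul]
  have hsum : ∑ i ∈ Finset.univ.filter (fun i => ξ ∈ χ i), w i = 1 := by
    rw [← hw.2, Finset.sum_filter]
    refine Finset.sum_congr rfl fun i _ => ?_
    split_ifs with hi
    · rfl
    · rw [h i hi]
  rw [he2]
  refine (convex_convexHull ℝ _).sum_mem (fun i _ => hw.1 i) hsum fun i hi => ?_
  refine subset_convexHull ℝ _ ⟨i, ?_, rfl⟩
  simpa using hi

theorem exists_subseq_state {F : Type*} [NormedAddCommGroup F]
    {𝒯 : Set (Sol 𝒳 f)} {h : ℝ → E n → Fin N → F} {t : ℕ → ℝ} {T : ℕ → Sol 𝒳 f}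
    (hf_bdd : ∀ i, UnifBounded 𝒳 fun t ξ => f t ξ i) (H : ZeroingOutputSeq 𝒯 h t T) :
    ∃ φ : ℕ → ℕ, StrictMono φ ∧ ∃ z : ℝ → E n, Continuous z ∧
      ∀ s, Tendsto (fun k => (T (φ k)).x (t (φ k) + s)) atTop (𝓝 (z s)) := by
  obtain ⟨-, -, h3, ⟨K, hK, hK', ε, hε, h4⟩, -⟩ := H
  obtain ⟨C, hC0, hC⟩ := unifBounded_fam hf_bdd hK hK'
  obtain ⟨R, hR⟩ := hK.isBounded.exists_norm_le
  have hcl : ∀ (k : ℕ) s, |clamp k s| ≤ (k:ℝ) := fun k s => abs_clamp_le (Nat.cast_nonneg k) s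
  obtain ⟨φ, hφ, z, hz, hlim⟩ := exists_subseq_lip ⟨C, hC0⟩
    (fun k s => (T k).x (t k + clamp k s)) (by
      intro k
      refine LipschitzWith.of_dist_le_mul fun s r => ?_
      rw [dist_eq_norm, Real.dist_eq]
      refine (sol_lip (T k) hC (t k) k (h3 k).1 (h3 k).2 (fun s hs => (h4 k s hs).1)
        _ _ (hcl k s) (hcl k r)).trans ?_
      exact mul_le_mul_of_nonneg_left (clamp_lip _ _ _) hC0) R
    (fun k => hR _ (h4 k _ (hcl k 0)).1)
  refine ⟨φ, hφ, z, hz.continuous, fun s => (hlim s).congr' ?_⟩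
  filter_upwards [hφ.tendsto_atTop.eventually (eventually_mem_win s)] with k hk
  rw [clamp_eq hk]

theorem core_false {p : ℕ} (fhat Δf : ℝ → E n → Fin N → E n)
    (h : ℝ → E n → Fin N → EuclideanSpace ℝ (Fin p))
    (hdecomp : ∀ t ξ i, f t ξ i = fhat t ξ i + Δf t ξ i)
    (hf_car : ∀ i, Caratheodory 𝒳 fun t ξ => f t ξ i)
    (hf_bdd : ∀ i, UnifBounded 𝒳 fun t ξ => f t ξ i)
    (hh_bdd : ∀ i, UnifBounded 𝒳 fun t ξ => h t ξ i)
    (hh_meas : ∀ i, ∀ ξ ∈ 𝒳, Measurable fun t => h t ξ i)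
    (hh_cont : ∀ i, ContXiUnifT 𝒳 fun t ξ => h t ξ i)
    (hfhat_bdd : ∀ i, UnifBounded 𝒳 fun t ξ => fhat t ξ i)
    (hfhat_meas : ∀ i, ∀ ξ ∈ 𝒳, Measurable fun t => fhat t ξ i)
    (hfhat_cont : ∀ i, ContXiUnifT 𝒳 fun t ξ => fhat t ξ i)
    (hzp : ∀ i, ZeroingPair 𝒳 (fun t ξ => h t ξ i) fun t ξ => Δf t ξ i)
    (𝒯 : Set (Sol 𝒳 f))
    (χ : Fin N → Set (E n)) (hχ_closed : ∀ i, IsClosed (χ i)) (hinv : InvariantWrt 𝒯 χ)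
    (t : ℕ → ℝ) (T : ℕ → Sol 𝒳 f) (H : ZeroingOutputSeq 𝒯 h t T)
    (fl : Fin N → ℝ → E n → E n) (hl : Fin N → ℝ → E n → EuclideanSpace ℝ (Fin p))
    (hfl : ∀ i, IsLimitAlong 𝒳 (fun t ξ => fhat t ξ i) t (fl i))
    (hhl : ∀ i, IsLimitAlong 𝒳 (fun t ξ => h t ξ i) t (hl i))
    (z : ℝ → E n) (hzc : Continuous z)
    (hxz : ∀ s, Tendsto (fun k => (T k).x (t k + s)) atTop (𝓝 (z s)))
    (u : ℝ → Fin N → ℝ) (hu : IsControl u)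
    (hw : WeakConv (fun k s => ctrlOfSwitch (T k).σ (t k + s)) u) :
    BoundedRange 𝒳 z ∧ CompleteTrajOf 𝒯 χ fl hl z u ∧ ∃ ε > 0, ∀ s, ε ≤ ‖z s‖ := by
  obtain ⟨ht, hT, hdom, ⟨K, hK, hK', ε, hε, hx⟩, hout⟩ := H
  have hcl : ∀ (k : ℕ) s, |clamp k s| ≤ (k:ℝ) := fun k s => abs_clamp_le (Nat.cast_nonneg k) s
  obtain ⟨Cf, hCf0, hCf⟩ := unifBounded_fam hf_bdd hK hK'
  obtain ⟨Cg, hCg0, hCg⟩ := unifBounded_fam hfhat_bdd hK hK'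
  obtain ⟨Ch, hCh0, hCh⟩ := unifBounded_fam hh_bdd hK hK'
  set y : ℕ → ℝ → E n := fun k s => (T k).x (t k + clamp k s) with hy
  have hyK : ∀ k s, y k s ∈ K := fun k s => (hx k _ (hcl k s)).1
  have hyε : ∀ k s, ε ≤ ‖y k s‖ := fun k s => (hx k _ (hcl k s)).2
  have hyeq : ∀ (k : ℕ) s, s ∈ Icc (-(k:ℝ)) k → y k s = (T k).x (t k + s) := by
    intro k s hs
    simp only [hy, clamp_eq hs]
  have hyc : ∀ k, Continuous (y k) := by
    intro k
    have : LipschitzWith ⟨Cf, hCf0⟩ (y k) := by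
      refine LipschitzWith.of_dist_le_mul fun s r => ?_
      rw [dist_eq_norm, Real.dist_eq]
      refine (sol_lip (T k) hCf (t k) k (hdom k).1 (hdom k).2 (fun s hs => (hx k s hs).1)
        _ _ (hcl k s) (hcl k r)).trans ?_
      exact mul_le_mul_of_nonneg_left (clamp_lip _ _ _) hCf0
    exact this.continuous
  have hyz : ∀ s, Tendsto (fun k => y k s) atTop (𝓝 (z s)) := by
    intro s
    refine (hxz s).congr' ?_
    filter_upwards [eventually_mem_win s] with k hk
    rw [hyeq k s hk]
  have hzK : ∀ s, z s ∈ K := fun s =>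
    hK.isClosed.mem_of_tendsto (hyz s) (Eventually.of_forall fun k => hyK k s)
  have hzε : ∀ s, ε ≤ ‖z s‖ := fun s =>
    ge_of_tendsto (hyz s).norm (Eventually.of_forall fun k => hyε k s)
  have htk : ∀ k : ℕ, (k:ℝ) ≤ t k := fun k => by linarith [(hdom k).1, (T k).t0_nonneg]
  set v : ℕ → ℝ → Fin N → ℝ := fun k s => ctrlOfSwitch (T k).σ (t k + s) with hv
  have hvm : ∀ k, Measurable (v k) := fun k => ctrl_measurable (T k).switching (t k)
  have hvi : ∀ k i, Measurable (fun s => v k s i) := fun k i =>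
    (measurable_pi_apply i).comp (hvm k)
  have hui : ∀ i, Measurable (fun t => u t i) := fun i => (measurable_pi_apply i).comp hu.1
  have hvs : ∀ k s, v k s ∈ simplexU N := fun k s => stdVec_mem _
  have hvsum : ∀ {V : Type} [AddCommGroup V] [Module ℝ V] (k s) (w : Fin N → V),
      ∑ j, v k s j • w j = w ((T k).σ (t k + s)) := fun k s w => sum_stdVec_smul _ w
  have hvsum' : ∀ (k s) (w : Fin N → ℝ),
      ∑ j, v k s j * w j = w ((T k).σ (t k + s)) := fun k s w => sum_stdVec_smul _ w
  -- windowed compositions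
  set G : ℕ → ℝ → Fin N → E n := fun k s i => win (fun t ξ => fhat t ξ i) (t k) k (y k) s with hG
  set W : ℕ → ℝ → Fin N → E n := fun k s i => win (fun t ξ => f t ξ i) (t k) k (y k) s with hW
  set Q : ℕ → ℝ → Fin N → EuclideanSpace ℝ (Fin p) :=
    fun k s i => win (fun t ξ => h t ξ i) (t k) k (y k) s with hQ
  have hGm : ∀ k i, AEStronglyMeasurable (fun s => G k s i) volume := fun k i =>
    win_aesm hK _ (fun ξ hξ => hfhat_meas i ξ (hK' hξ)) ((hfhat_cont i).ae_cont hK hK') _ _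
      (htk k) _ (hyc k) (hyK k)
  have hQm : ∀ k i, AEStronglyMeasurable (fun s => Q k s i) volume := fun k i =>
    win_aesm hK _ (fun ξ hξ => hh_meas i ξ (hK' hξ)) ((hh_cont i).ae_cont hK hK') _ _
      (htk k) _ (hyc k) (hyK k)
  have hWm : ∀ k i, AEStronglyMeasurable (fun s => W k s i) volume := fun k i =>
    win_aesm hK _ (fun ξ hξ => (hf_car i).1 ξ (hK' hξ)) (by
      have := (ae_restrict_iff' measurableSet_Ici).1 (hf_car i).2.1
      filter_upwards [this] with τ hτ h0
      exact (hτ h0).mono hK') _ _ (htk k) _ (hyc k) (hyK k)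
  have hGb : ∀ k i, ∀ᵐ s, ‖G k s i‖ ≤ Cg := fun k i =>
    win_bound _ hCg0 (by filter_upwards [hCg] with τ hτ h0 ξ hξ using hτ h0 ξ hξ i) _ _ (htk k) _
      (hyK k)
  have hQb : ∀ k i, ∀ᵐ s, ‖Q k s i‖ ≤ Ch := fun k i =>
    win_bound _ hCh0 (by filter_upwards [hCh] with τ hτ h0 ξ hξ using hτ h0 ξ hξ i) _ _ (htk k) _
      (hyK k)
  have hWb : ∀ k i, ∀ᵐ s, ‖W k s i‖ ≤ Cf := fun k i =>
    win_bound _ hCf0 (by filter_upwards [hCf] with τ hτ h0 ξ hξ using hτ h0 ξ hξ i) _ _ (htk k) _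
      (hyK k)
  have hGl : ∀ i, ∀ᵐ s, Tendsto (fun k => G k s i) atTop (𝓝 (fl i s (z s))) := fun i =>
    win_tendsto hK hK' _ (hfhat_cont i) t htk _ (hfl i) y hyK z hzK hyz
  have hQl : ∀ i, ∀ᵐ s, Tendsto (fun k => Q k s i) atTop (𝓝 (hl i s (z s))) := fun i =>
    win_tendsto hK hK' _ (hh_cont i) t htk _ (hhl i) y hyK z hzK hyz
  -- the output constraint
  have hout0 : ∀ᵐ s, ∑ i, u s i * ‖hl i s (z s)‖ = 0 := by
    refine conv_ae_zero hvm hvs hu hw (fun k s i => ‖Q k s i‖) (fun s i => ‖hl i s (z s)‖) Ch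
      (fun k i => (hQm k i).norm) (fun k i => ?_) (fun i => ?_) (fun s i => norm_nonneg _) ?_
    · filter_upwards [hQb k i] with s hs
      simpa using hs
    · filter_upwards [hQl i] with s hs using hs.norm
    · filter_upwards [hout] with s hs
      simp_rw [hvsum']
      have := hs.norm
      rw [norm_zero] at this
      refine this.congr' ?_
      filter_upwards [eventually_mem_win s] with k hk
      simp [hQ, win, hk, hyeq k s hk]
  -- the covering constraint
  have hcov : ∀ i, ∀ᵐ s, z s ∉ χ i → u s i = 0 := by
    intro i
    classical
    set A : Set ℝ := {s | z s ∉ χ i} with hA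
    have hAo : IsOpen A := (hχ_closed i).isOpen_compl.preimage hzc
    have key := conv_ae_zero hvm hvs hu hw
      (fun _ s j => if j = i then A.indicator (fun _ => (1:ℝ)) s else 0)
      (fun s j => if j = i then A.indicator (fun _ => (1:ℝ)) s else 0) 1
      (fun k j => ?_) (fun k j => ?_) (fun j => ?_) (fun s j => ?_) ?_
    · filter_upwards [key] with s hs hsA
      have : s ∈ A := hsA
      simpa [this] using hs
    · by_cases hj : j = i
      · simp only [hj, if_true]
        exact (measurable_const.indicator hAo.measurableSet).aestronglyMeasurable
      · simp only [hj, if_false]; exact aestronglyMeasurable_const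
    · refine Eventually.of_forall fun s => ?_
      by_cases hj : j = i <;> by_cases hs : s ∈ A <;> simp [hj, hs]
    · exact Eventually.of_forall fun s => tendsto_const_nhds
    · by_cases hj : j = i <;> by_cases hs : s ∈ A <;> simp [hj, hs]
    · refine Eventually.of_forall fun s => ?_
      simp_rw [hvsum']
      by_cases hs : s ∈ A
      · refine tendsto_const_nhds.congr' ?_
        have hev := (hyz s).eventually ((hχ_closed i).isOpen_compl.mem_nhds hs)
        filter_upwards [hev, eventually_mem_win s] with k h1 h2
        have h3 : (T k).σ (t k + s) ≠ i := by
          intro hcon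
          refine h1 ?_
          rw [hyeq k s h2, ← hcon]
          refine hinv (T k) (hT k) _ ⟨by linarith [(hdom k).1, h2.1], ?_⟩
          exact lt_of_le_of_lt (EReal.coe_le_coe_iff.2 (by linarith [h2.2])) (hdom k).2
        simp [h3]
      · simp [hs]
  -- the dynamics
  set g : ℝ → E n := fun s => ∑ i, u s i • fl i s (z s) with hg
  have hflm : ∀ i, AEStronglyMeasurable (fun s => fl i s (z s)) volume := fun i =>
    aestronglyMeasurable_of_tendsto_ae atTop (fun k => hGm k i) (hGl i)
  have hflb : ∀ i, ∀ᵐ s, ‖fl i s (z s)‖ ≤ Cg := by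
    intro i
    filter_upwards [hGl i, ae_all_iff.2 fun k => hGb k i] with s h1 h2
    exact le_of_tendsto h1.norm (Eventually.of_forall h2)
  have bnd : ∀ (D : ℝ) (w : Fin N → ℝ) (q : Fin N → E n), w ∈ simplexU N → (∀ i, ‖q i‖ ≤ D) →
      ‖∑ i, w i • q i‖ ≤ D := by
    intro D w q h1 h2
    refine (norm_sum_le _ _).trans ?_
    calc ∑ i, ‖w i • q i‖ ≤ ∑ i, w i * D := by
          refine Finset.sum_le_sum fun i _ => ?_
          rw [norm_smul, Real.norm_eq_abs, abs_of_nonneg (h1.1 i)]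
          exact mul_le_mul_of_nonneg_left (h2 i) (h1.1 i)
      _ = D := by rw [← Finset.sum_mul, h1.2, one_mul]
  have hgm : AEStronglyMeasurable g volume :=
    Finset.aestronglyMeasurable_fun_sum _ fun i _ => (hui i).aestronglyMeasurable.smul (hflm i)
  have hgb : ∀ᵐ s, ‖g s‖ ≤ Cg := by
    filter_upwards [ae_all_iff.2 hflb] with s hs using bnd _ _ _ (hu.2 s) hs
  have hPm : ∀ k, AEStronglyMeasurable (fun s => ∑ i, v k s i • G k s i) volume := fun k =>
    Finset.aestronglyMeasurable_fun_sum _ fun i _ => (hvi k i).aestronglyMeasurable.smul (hGm k i)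
  have hPb : ∀ k, ∀ᵐ s, ‖∑ i, v k s i • G k s i‖ ≤ Cg := by
    intro k
    filter_upwards [ae_all_iff.2 fun i => hGb k i] with s hs using bnd _ _ _ (hvs k s) hs
  have hFm : ∀ k, AEStronglyMeasurable (fun s => ∑ i, v k s i • W k s i) volume := fun k =>
    Finset.aestronglyMeasurable_fun_sum _ fun i _ => (hvi k i).aestronglyMeasurable.smul (hWm k i)
  have hFb : ∀ k, ∀ᵐ s, ‖∑ i, v k s i • W k s i‖ ≤ Cf := by
    intro k
    filter_upwards [ae_all_iff.2 fun i => hWb k i] with s hs using bnd _ _ _ (hvs k s) hs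
  have hdelta : ∀ᵐ s, Tendsto (fun k => (∑ i, v k s i • W k s i) - ∑ i, v k s i • G k s i)
      atTop (𝓝 0) := by
    filter_upwards [hout] with s hs
    have h1 := zeroing_switched h Δf hzp hK hK' hε (fun k => t k + s)
      (tendsto_atTop_add_const_right _ s ht) (fun k => y k s) (fun k => (T k).σ (t k + s))
      (fun k => hyK k s) (fun k => hyε k s) (by
        refine hs.congr' ?_
        filter_upwards [eventually_mem_win s] with k hk
        rw [hyeq k s hk])
    refine h1.congr' ?_
    filter_upwards [eventually_mem_win s] with k hk
    rw [hvsum, hvsum]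
    simp [hW, hG, win, hk, hdecomp]
  have hdyn : ∀ a b, a ≤ b → z b - z a = ∫ s in a..b, g s := by
    intro a b hab
    rw [intervalIntegral.integral_of_le hab]
    set A := Ioc a b with hA
    have hAf : volume A < ⊤ := by simp [hA]
    have hAm : MeasurableSet A := measurableSet_Ioc
    have hintegr : ∀ {q : ℝ → E n} (D : ℝ), AEStronglyMeasurable q volume → (∀ᵐ s, ‖q s‖ ≤ D) →
        IntegrableOn q A volume := fun D h1 h2 =>
      Measure.integrableOn_of_bounded (M := D) hAf.ne h1 (ae_restrict_of_ae h2)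
    have h2 : Tendsto (fun k => ∫ s in A, ((∑ i, v k s i • W k s i) - ∑ i, v k s i • G k s i))
        atTop (𝓝 0) := by
      have h0 : (0 : E n) = ∫ s in A, (0 : E n) := by simp
      rw [h0]
      refine tendsto_integral_of_dominated_convergence (fun _ => Cf + Cg)
        (fun k => ((hFm k).sub (hPm k)).restrict) (integrableOn_const hAf.ne) (fun k => ?_)
        (ae_restrict_of_ae hdelta)
      refine ae_restrict_of_ae ?_
      filter_upwards [hFb k, hPb k] with s h1 h2
      exact (norm_sub_le _ _).trans (add_le_add h1 h2)
    have h3 : Tendsto (fun k => ∫ s in A, ∑ i, v k s i • W k s i) atTop (𝓝 (z b - z a)) := by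
      refine ((hyz b).sub (hyz a)).congr' ?_
      filter_upwards [eventually_mem_win a, eventually_mem_win b] with k ha hb
      rw [hyeq k a ha, hyeq k b hb]
      have h1 := (T k).sol (t k + a) (t k + b) (by linarith [(hdom k).1, ha.1]) (by linarith)
        (lt_of_le_of_lt (EReal.coe_le_coe_iff.2 (by linarith [hb.2])) (hdom k).2)
      rw [h1, add_sub_cancel_left, ← intervalIntegral.integral_comp_add_left
        (fun τ => f τ ((T k).x τ) ((T k).σ τ)) (t k), intervalIntegral.integral_of_le hab]
      refine setIntegral_congr_fun hAm fun s hs => ?_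
      have hs' : s ∈ Icc (-(k:ℝ)) k := ⟨by linarith [ha.1, hs.1], by linarith [hb.2, hs.2]⟩
      rw [hvsum]
      simp [hW, win, hs', hyeq k s hs']
    have h4 : Tendsto (fun k => ∫ s in A, ∑ i, v k s i • G k s i) atTop (𝓝 (z b - z a)) := by
      have := h3.sub h2
      rw [sub_zero] at this
      refine this.congr fun k => ?_
      rw [integral_sub (hintegr Cf (hFm k) (hFb k)) (hintegr Cg (hPm k) (hPb k))]
      abel
    ext j
    let L : E n →L[ℝ] ℝ := EuclideanSpace.proj j
    have hLapp : ∀ q : E n, L q = q j := fun q => rfl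
    have h5 := (L.continuous.tendsto _).comp h4
    have h6 := conv_lemma hvm hvs hw (fun k s i => G k s i j) (fun s i => fl i s (z s) j) Cg
      (fun k i => L.continuous.comp_aestronglyMeasurable (hGm k i))
      (fun k i => by
        filter_upwards [hGb k i] with s hs
        exact (PiLp.norm_apply_le (G k s i) j).trans hs)
      (fun i => by
        filter_upwards [hGl i] with s hs
        exact (L.continuous.tendsto _).comp hs) A hAm hAf
    have h7 : L (∫ s in A, g s) = ∫ s in A, ∑ i, u s i * fl i s (z s) j := by
      rw [← L.integral_comp_comm (hintegr Cg hgm hgb)]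
      congr 1; ext s
      simp [hg, map_sum, hLapp]
    have h8 : L (z b - z a) = L (∫ s in A, g s) := by
      rw [h7]
      refine tendsto_nhds_unique h5 (h6.congr fun k => ?_)
      simp only [Function.comp]
      rw [← L.integral_comp_comm (hintegr Cg (hPm k) (hPb k))]
      congr 1; ext s
      simp [map_sum, hLapp]
    exact h8
  have hgi : ∀ a b, IntervalIntegrable g volume a b := intervalIntegrable_of_bdd hgm hgb
  have hzint : ∀ s, z s = z 0 + ∫ τ in (0:ℝ)..s, g τ := by
    intro s
    rcases le_total 0 s with h0 | h0
    · rw [← hdyn 0 s h0]; abel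
    · rw [intervalIntegral.integral_symm, ← hdyn s 0 h0]; abel
  have hgloc : LocallyIntegrable g volume := by
    rw [locallyIntegrable_iff]
    intro S hS
    exact Measure.integrableOn_of_bounded (M := Cg) hS.measure_lt_top.ne hgm
      (ae_restrict_of_ae hgb)
  refine ⟨⟨K, hK, hK', hzK⟩, ⟨fun s => hK' (hzK s), ⟨g, hgi, hzint⟩,
    ⟨hu, t, T, ht, hT, hw⟩, ?_⟩, ε, hε, hzε⟩
  filter_upwards [ae_all_iff.2 hcov, hout0, LocallyIntegrable.ae_hasDerivAt_integral hgloc] with s h1 h2 h3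
  refine ⟨mem_Uset_of (hu.2 s) h1, ?_, h2⟩
  have h4 := (h3 0).const_add (z 0)
  exact h4.congr_of_eventuallyEq (Eventually.of_forall hzint)

end SwitchedSys

open SwitchedSys Filter Set MeasureTheory

/-- Theorem 3 (criterion for WZSD): under Assumptions 2 and 3, if every reduced limiting
control system Σ_γ for 𝒯 is WZSD (every bounded complete trajectory satisfies
inf_{t∈ℝ}|x(t)| = 0), then the pair (h,f) is WZSD with respect to 𝒯. -/
theorem wzsd_of_reduced_systems_wzsd
    {n N p : ℕ} (𝒳 : Set (E n)) (hXopen : IsOpen 𝒳) (hX0 : (0 : E n) ∈ 𝒳)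
    (f fhat Δf : ℝ → E n → Fin N → E n)
    (h : ℝ → E n → Fin N → EuclideanSpace ℝ (Fin p))
    (hdecomp : ∀ t ξ i, f t ξ i = fhat t ξ i + Δf t ξ i)
    (hf_car : ∀ i, Caratheodory 𝒳 fun t ξ => f t ξ i)
    (hf_bdd : ∀ i, UnifBounded 𝒳 fun t ξ => f t ξ i)
    (hh_bdd : ∀ i, UnifBounded 𝒳 fun t ξ => h t ξ i)
    (hh_meas : ∀ i, ∀ ξ ∈ 𝒳, Measurable fun t => h t ξ i)
    (hh_cont : ∀ i, ContXiUnifT 𝒳 fun t ξ => h t ξ i)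
    (hh_pre : ∀ i, Precompact 𝒳 fun t ξ => h t ξ i)
    (hfhat_bdd : ∀ i, UnifBounded 𝒳 fun t ξ => fhat t ξ i)
    (hfhat_meas : ∀ i, ∀ ξ ∈ 𝒳, Measurable fun t => fhat t ξ i)
    (hfhat_cont : ∀ i, ContXiUnifT 𝒳 fun t ξ => fhat t ξ i)
    (hfhat_pre : ∀ i, Precompact 𝒳 fun t ξ => fhat t ξ i)
    (hzp : ∀ i, ZeroingPair 𝒳 (fun t ξ => h t ξ i) fun t ξ => Δf t ξ i)
    (𝒯 : Set (Sol 𝒳 f)) (hmax : ∀ T ∈ 𝒯, T.IsMaximal)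
    (χ : Fin N → Set (E n)) (hχ_closed : ∀ i, IsClosed (χ i))
    (hχ_cover : (⋃ i, χ i) = Set.univ) (hinv : InvariantWrt 𝒯 χ)
    -- every reduced limiting control system Σ_γ, γ ∈ Λ, is WZSD
    (hred : ∀ γ : ℕ → ℝ, Tendsto γ atTop atTop →
      ∀ (fl : Fin N → ℝ → E n → E n)
        (hlm : Fin N → ℝ → E n → EuclideanSpace ℝ (Fin p)),
        (∀ i, IsLimitAlong 𝒳 (fun t ξ => fhat t ξ i) γ (fl i)) →
        (∀ i, IsLimitAlong 𝒳 (fun t ξ => h t ξ i) γ (hlm i)) →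
        ∀ (x : ℝ → E n) (u : ℝ → Fin N → ℝ),
          BoundedRange 𝒳 x → CompleteTrajOf 𝒯 χ fl hlm x u →
          (⨅ t : ℝ, ‖x t‖) = 0) :
    WZSD 𝒯 h := by
  rintro ⟨t, T, hZ⟩
  obtain ⟨φ1, hφ1, fl, hfl⟩ := exists_subseq_limits (fun i t ξ => fhat t ξ i) hfhat_pre t hZ.1
  have hZ1 := hZ.subseq hφ1
  obtain ⟨φ2, hφ2, hl, hhl⟩ := exists_subseq_limits (fun i t ξ => h t ξ i) hh_pre _ hZ1.1
  have hZ2 := hZ1.subseq hφ2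
  obtain ⟨φ3, hφ3, z, hzc, hxz⟩ := exists_subseq_state hf_bdd hZ2
  have hZ3 := hZ2.subseq hφ3
  obtain ⟨φ4, hφ4, u, hu, hw⟩ := weak_compact
    (fun k s => ctrlOfSwitch ((((T ∘ φ1) ∘ φ2) ∘ φ3) k).σ ((((t ∘ φ1) ∘ φ2) ∘ φ3) k + s))
    (fun k => ctrl_measurable ((((T ∘ φ1) ∘ φ2) ∘ φ3) k).switching _)
    (fun k s => stdVec_mem _)
  have hZ4 := hZ3.subseq hφ4
  have hfl4 := fun i => (((hfl i).subseq hφ2).subseq hφ3).subseq hφ4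
  have hhl4 := fun i => ((hhl i).subseq hφ3).subseq hφ4
  obtain ⟨hB, hC, ε, hε, hzε⟩ := core_false fhat Δf h hdecomp hf_car hf_bdd hh_bdd hh_meas
    hh_cont hfhat_bdd hfhat_meas hfhat_cont hzp 𝒯 χ hχ_closed hinv _ _ hZ4 fl hl hfl4 hhl4
    z hzc (fun s => (hxz s).comp hφ4.tendsto_atTop) u hu hw
  have h1 := hred _ hZ4.1 fl hl hfl4 hhl4 z u hB hC
  have h2 : ε ≤ ⨅ t, ‖z t‖ := le_ciInf hzε
  linarith
end
end
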